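/- Fix any constant C ≥ 0.1. There exists ℓ ∈ ℕ (depending only on C) such that for every sequence (p_n) with 0.1/n ≤ p_n ≤ C/n and every ε > 0, with high probability the binomial random digraph D ~ 𝔻(n, p_n) admits a vertex subset U ⊆ V(D), an assignment of a colour c(v) ∈ {1,2,3} to each v ∉ U, and an assignment of a list L(v) ⊆ {1,2,3} to each v ∈ U, satisfying: (L1) for any completion of the partial colouring c obtained by assigning to each v ∈ U some colour in L(v), every vertex v ∉ U is majority-coloured with respect to the completed colouring; (L2) |U| ≤ εn; (L3) each v ∈ U has |L(v)| = 2 or |L(v)| = 3; (L4) every directed cycle in the subdigraph induced by U contains at least two vertices v with |L(v)| = 3; (L5) every directed path of length ℓ in the subdigraph induced by U contains a vertex v with |L(v)| = 3. -/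

import Mathlib

open MeasureTheory Filter

/-- Bernoulli measure on `Bool` with parameter `p`. -/
noncomputable def bernoulliM (p : ℝ) : Measure Bool :=
  (Real.toNNReal p) • Measure.dirac true + (Real.toNNReal (1 - p)) • Measure.dirac false

instance (p : ℝ) : IsFiniteMeasure (bernoulliM p) := by
  unfold bernoulliM; infer_instance

/-- The binomial random digraph measure `𝔻(n,p)`: each of the `n(n-1)` possible arcs
(ordered pairs of distinct vertices) is present independently with probability `p`
(the diagonal entries of the matrix are ignored, via `DiAdj`). -/
noncomputable def diMeasure (n : ℕ) (p : ℝ) : Measure (Fin n → Fin n → Bool) :=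
  Measure.pi fun _ => Measure.pi fun _ => bernoulliM p

/-- The arc relation of the digraph encoded by the matrix `A`. -/
def DiAdj {n : ℕ} (A : Fin n → Fin n → Bool) (v w : Fin n) : Prop :=
  v ≠ w ∧ A v w = true

/-- A vertex `v` is *majority-coloured* with respect to the colouring `c` if at most
half of its out-neighbours have the same colour as `v`. -/
def MajorityAt {n : ℕ} {α : Type*} (A : Fin n → Fin n → Bool) (c : Fin n → α) (v : Fin n) :
    Prop :=
  2 * ({w | DiAdj A v w ∧ c w = c v} : Set (Fin n)).ncard ≤
    ({w | DiAdj A v w} : Set (Fin n)).ncard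


namespace WLA
open Finset

/-- Real-valued indicator of a proposition. -/
noncomputable def ind (P : Prop) : ℝ := open Classical in if P then 1 else 0

lemma ind_true {P : Prop} (h : P) : ind P = 1 := by simp [ind, h]
lemma ind_false {P : Prop} (h : ¬ P) : ind P = 0 := by simp [ind, h]
lemma ind_nonneg (P : Prop) : 0 ≤ ind P := by unfold ind; split_ifs <;> norm_num
lemma ind_le_one (P : Prop) : ind P ≤ 1 := by unfold ind; split_ifs <;> norm_num
lemma ind_mono {P Q : Prop} (h : P → Q) : ind P ≤ ind Q := by
  by_cases hP : P
  · rw [ind_true hP, ind_true (h hP)]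
  · rw [ind_false hP]; exact ind_nonneg _
lemma ind_congr {P Q : Prop} (h : P ↔ Q) : ind P = ind Q := by rw [propext h]
lemma ind_or_le (P Q : Prop) : ind (P ∨ Q) ≤ ind P + ind Q := by
  by_cases hP : P
  · rw [ind_true (Or.inl hP), ind_true hP]; linarith [ind_nonneg Q]
  · rw [ind_false hP, zero_add]; exact ind_mono (fun h => h.resolve_left hP)
lemma ind_and (P Q : Prop) : ind (P ∧ Q) = ind P * ind Q := by
  by_cases hP : P <;> by_cases hQ : Q <;> simp [ind, hP, hQ]
lemma ind_not (P : Prop) : ind (¬ P) = 1 - ind P := by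
  by_cases hP : P <;> simp [ind, hP]
lemma ind_exists_le {ι : Type*} (s : Finset ι) (P : ι → Prop) :
    ind (∃ i ∈ s, P i) ≤ ∑ i ∈ s, ind (P i) := by
  by_cases h : ∃ i ∈ s, P i
  · obtain ⟨i, hi, hP⟩ := h
    calc ind _ ≤ 1 := ind_le_one _
      _ = ind (P i) := (ind_true hP).symm
      _ ≤ _ := Finset.single_le_sum (f := fun i => ind (P i)) (fun j _ => ind_nonneg _) hi
  · rw [ind_false h]; exact Finset.sum_nonneg (fun j _ => ind_nonneg _)
lemma card_filter_eq_sum_ind {ι : Type*} (s : Finset ι) (P : ι → Prop) [DecidablePred P] :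
    ((s.filter P).card : ℝ) = ∑ i ∈ s, ind (P i) := by
  rw [Finset.card_filter]; push_cast
  refine Finset.sum_congr rfl fun i _ => ?_
  by_cases h : P i <;> simp [ind, h]
/-- Markov-type bound. -/
lemma ind_le_div {a b : ℝ} (ha : 0 ≤ a) (hb : 0 < b) : ind (b ≤ a) ≤ a / b := by
  by_cases h : b ≤ a
  · rw [ind_true h]; exact (one_le_div hb).2 h
  · rw [ind_false h]; positivity

section abs
variable {V D : Type*} [Fintype V] [DecidableEq V] [Fintype D]

noncomputable def wt (ω : D → ℝ) (x : V → D) : ℝ := ∏ v, ω (x v)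

noncomputable def Ex (ω : D → ℝ) (F : (V → D) → ℝ) : ℝ := ∑ x, wt ω x * F x

variable {ω : D → ℝ}

lemma wt_nonneg (h0 : ∀ d, 0 ≤ ω d) (x : V → D) : 0 ≤ wt ω x :=
  Finset.prod_nonneg fun _ _ => h0 _

lemma Ex_const (h1 : ∑ d, ω d = 1) (a : ℝ) : Ex (V := V) ω (fun _ => a) = a := by
  unfold Ex
  rw [← Finset.sum_mul]
  have : ∑ x : V → D, wt ω x = 1 := by
    have := Finset.prod_univ_sum (ι := V) (fun _ => (Finset.univ : Finset D)) (fun _ d => ω d)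
    simp only [h1, Finset.prod_const_one, Fintype.piFinset_univ] at this
    exact this.symm
  rw [this, one_mul]

lemma Ex_add (F G : (V → D) → ℝ) : Ex ω (fun x => F x + G x) = Ex ω F + Ex ω G := by
  simp [Ex, mul_add, Finset.sum_add_distrib]

lemma Ex_sub (F G : (V → D) → ℝ) : Ex ω (fun x => F x - G x) = Ex ω F - Ex ω G := by
  simp [Ex, mul_sub, Finset.sum_sub_distrib]

lemma Ex_mul_left (a : ℝ) (F : (V → D) → ℝ) : Ex ω (fun x => a * F x) = a * Ex ω F := by
  simp only [Ex, Finset.mul_sum]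
  exact Finset.sum_congr rfl fun x _ => by ring

lemma Ex_sum {ι : Type*} (s : Finset ι) (F : ι → (V → D) → ℝ) :
    Ex ω (fun x => ∑ i ∈ s, F i x) = ∑ i ∈ s, Ex ω (F i) := by
  simp only [Ex, Finset.mul_sum]
  rw [Finset.sum_comm]

lemma Ex_mono (h0 : ∀ d, 0 ≤ ω d) {F G : (V → D) → ℝ} (h : ∀ x, F x ≤ G x) :
    Ex ω F ≤ Ex ω G :=
  Finset.sum_le_sum fun x _ => mul_le_mul_of_nonneg_left (h x) (wt_nonneg h0 x)

lemma Ex_nonneg (h0 : ∀ d, 0 ≤ ω d) {F : (V → D) → ℝ} (h : ∀ x, 0 ≤ F x) :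
    0 ≤ Ex ω F :=
  Finset.sum_nonneg fun x _ => mul_nonneg (wt_nonneg h0 x) (h x)

lemma Ex_ind_le_one (h0 : ∀ d, 0 ≤ ω d) (h1 : ∑ d, ω d = 1) (P : (V → D) → Prop) :
    Ex ω (fun x => ind (P x)) ≤ 1 := by
  rw [← Ex_const (V := V) h1 1]
  exact Ex_mono h0 fun x => ind_le_one _

lemma wt_update (x : V → D) (v : V) (d : D) :
    wt ω (Function.update x v d) * ω (x v) = wt ω x * ω d := by
  unfold wt
  rw [← Finset.mul_prod_erase univ (fun u => ω (Function.update x v d u)) (mem_univ v),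
    ← Finset.mul_prod_erase univ (fun u => ω (x u)) (mem_univ v)]
  have : ∏ u ∈ univ.erase v, ω (Function.update x v d u) = ∏ u ∈ univ.erase v, ω (x u) :=
    Finset.prod_congr rfl fun u hu => by
      rw [Function.update_of_ne (Finset.ne_of_mem_erase hu)]
  rw [this]; simp; ring

/-- Resampling the data of one vertex does not change the expectation. -/
lemma Ex_resample (h1 : ∑ d, ω d = 1) (v : V) (F : (V → D) → ℝ) :
    Ex ω F = Ex ω (fun x => ∑ d, ω d * F (Function.update x v d)) := by
  have key : ∑ q : (V → D) × D, wt ω q.1 * ω q.2 * F q.1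
      = ∑ q : (V → D) × D, wt ω q.1 * ω q.2 * F (Function.update q.1 v q.2) := by
    refine Finset.sum_bij' (fun q _ => (Function.update q.1 v q.2, q.1 v))
      (fun q _ => (Function.update q.1 v q.2, q.1 v)) ?_ ?_ ?_ ?_ ?_
    · simp
    · simp
    · rintro ⟨x, d⟩ _; simp
    · rintro ⟨x, d⟩ _; simp
    · rintro ⟨x, d⟩ _
      simp only [Function.update_idem, Function.update_eq_self]
      rw [wt_update]
  rw [Fintype.sum_prod_type, Fintype.sum_prod_type] at key
  unfold Ex
  calc _ = ∑ x : V → D, ∑ d, wt ω x * ω d * F x := by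
        refine Finset.sum_congr rfl fun x _ => ?_
        rw [← Finset.sum_mul, ← Finset.mul_sum, h1, mul_one]
    _ = _ := key
    _ = _ := by
        refine Finset.sum_congr rfl fun x _ => ?_
        rw [Finset.mul_sum]
        exact Finset.sum_congr rfl fun d _ => by ring

/-- Independence of one row from a functional not depending on it (upper bound form). -/
lemma Ex_row_indep (h1 : ∑ d, ω d = 1) (v : V) (f : D → ℝ) (G : (V → D) → ℝ)
    (hG : ∀ x d, G (Function.update x v d) = G x) :
    Ex ω (fun x => f (x v) * G x) = (∑ d, ω d * f d) * Ex ω G := by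
  rw [Ex_resample h1 v]
  simp only [Function.update_self, hG]
  rw [← Ex_mul_left]
  congr 1; funext x
  rw [Finset.sum_mul]
  exact Finset.sum_congr rfl fun d _ => by ring

/-- Use `y` on `E`, `y'` elsewhere. -/
def mix (E : Finset V) (y y' : V → D) : V → D := fun v => if v ∈ E then y v else y' v

lemma wt_mix (E : Finset V) (y y' : V → D) :
    wt ω (mix E y y') * wt ω (mix E y' y) = wt ω y * wt ω y' := by
  unfold wt mix
  rw [← Finset.prod_mul_distrib, ← Finset.prod_mul_distrib]
  refine Finset.prod_congr rfl fun v _ => ?_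
  split_ifs <;> ring

/-- Stopping-set decoupling. -/
lemma Ex_mix (h1 : ∑ d, ω d = 1) (E : (V → D) → Finset V)
    (hE : ∀ x y, (∀ v ∈ E x, y v = x v) → E y = E x) (F : (V → D) → ℝ) :
    Ex ω F = Ex ω (fun y => Ex ω (fun y' => F (mix (E y) y y'))) := by
  have hEm : ∀ x y, E (mix (E x) x y) = E x := fun x y =>
    hE _ _ fun v hv => by simp [mix, hv]
  have key : ∑ q : (V → D) × (V → D), wt ω q.1 * wt ω q.2 * F q.1
      = ∑ q : (V → D) × (V → D), wt ω q.1 * wt ω q.2 * F (mix (E q.1) q.1 q.2) := by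
    have inv : ∀ x y : V → D, mix (E x) (mix (E x) x y) (mix (E x) y x) = x := by
      intro x y; funext v; by_cases h : v ∈ E x <;> simp [mix, h]
    have inv2 : ∀ x y : V → D, mix (E x) (mix (E x) y x) (mix (E x) x y) = y := by
      intro x y; funext v; by_cases h : v ∈ E x <;> simp [mix, h]
    refine Finset.sum_bij' (fun q _ => (mix (E q.1) q.1 q.2, mix (E q.1) q.2 q.1))
      (fun q _ => (mix (E q.1) q.1 q.2, mix (E q.1) q.2 q.1)) ?_ ?_ ?_ ?_ ?_
    · simp
    · simp
    · rintro ⟨x, d⟩ _; simp [hEm, inv, inv2]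
    · rintro ⟨x, d⟩ _; simp [hEm, inv, inv2]
    · rintro ⟨x, d⟩ _
      simp only [hEm, inv]
      rw [wt_mix]
  rw [Fintype.sum_prod_type, Fintype.sum_prod_type] at key
  have h2 := Ex_const (V := V) h1 1
  simp only [Ex, mul_one] at h2
  unfold Ex
  calc _ = ∑ x : V → D, ∑ y, wt ω x * wt ω y * F x := by
        refine Finset.sum_congr rfl fun x _ => ?_
        rw [← Finset.sum_mul, ← Finset.mul_sum, h2, mul_one]
    _ = _ := key
    _ = _ := by
        refine Finset.sum_congr rfl fun x _ => ?_
        rw [Finset.mul_sum]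
        exact Finset.sum_congr rfl fun d _ => by ring

/-- Out-ball of radius `r`. -/
def ball (S : D → Finset V) (x : V → D) : ℕ → V → Finset V
  | 0, u => {u}
  | r + 1, u => insert u ((S (x u)).biUnion (ball S x r))

variable {S : D → Finset V}

lemma self_mem_ball (x : V → D) (r : ℕ) (u : V) : u ∈ ball S x r u := by
  cases r <;> simp [ball]

lemma ball_succ_of_mem {x : V → D} {r : ℕ} {u w z : V} (hw : w ∈ S (x u))
    (hz : z ∈ ball S x r w) : z ∈ ball S x (r + 1) u := by
  simp only [ball, mem_insert, mem_biUnion]; exact Or.inr ⟨w, hw, hz⟩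

lemma ball_mono_succ (x : V → D) (r : ℕ) : ∀ u, ball S x r u ⊆ ball S x (r + 1) u := by
  induction r with
  | zero => intro u; simp [ball]
  | succ r ih =>
    intro u z hz
    simp only [ball, mem_insert, mem_biUnion] at hz ⊢
    rcases hz with rfl | ⟨w, hw, hz⟩
    · exact Or.inl rfl
    · right; exact ⟨w, hw, by simpa [ball] using ih w hz⟩

lemma ball_local (r : ℕ) : ∀ (x y : V → D) (u : V), (∀ v ∈ ball S x r u, y v = x v) →
    ball S y r u = ball S x r u := by
  induction r with
  | zero => intros; rfl
  | succ r ih =>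
    intro x y u h
    have hu : y u = x u := h u (self_mem_ball _ _ _)
    simp only [ball, hu]
    congr 1
    refine Finset.biUnion_congr rfl fun w hw => ih x y w fun v hv => h v (ball_succ_of_mem hw hv)

lemma ball_update_subset {e : D} (he : S e = ∅) (x : V → D) (u : V) (r : ℕ) :
    ∀ w, ball S (Function.update x u e) r w ⊆ ball S x r w := by
  induction r with
  | zero => intro w; simp [ball]
  | succ r ih =>
    intro w z hz
    simp only [ball, mem_insert, mem_biUnion] at hz ⊢
    rcases hz with rfl | ⟨y, hy, hz⟩
    · exact Or.inl rfl
    · right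
      by_cases hwu : w = u
      · subst hwu; simp [he] at hy
      · rw [Function.update_of_ne hwu] at hy
        exact ⟨y, hy, ih y hz⟩

lemma ball_avoid (e : D) (x : V → D) (u z : V) (r : ℕ) :
    ∀ w, z ∈ ball S x r w → z ∈ ball S (Function.update x u e) r w ∨ z = u ∨
      ∃ y ∈ S (x u), z ∈ ball S (Function.update x u e) r y := by
  induction r with
  | zero => intro w h; left; simpa [ball] using h
  | succ r ih =>
    intro w h
    simp only [ball, mem_insert, mem_biUnion] at h
    rcases h with rfl | ⟨y, hy, hz⟩
    · left; exact self_mem_ball _ _ _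
    · rcases ih y hz with h1 | h1 | ⟨y', hy', h1⟩
      · by_cases hwu : w = u
        · subst hwu
          right; right; exact ⟨y, hy, ball_mono_succ _ _ _ h1⟩
        · left
          refine ball_succ_of_mem (w := y) ?_ h1
          rwa [Function.update_of_ne hwu]
      · exact Or.inr (Or.inl h1)
      · exact Or.inr (Or.inr ⟨y', hy', ball_mono_succ _ _ _ h1⟩)

/-- Bounds for expected in-balls. -/
noncomputable def KK (C : ℝ) : ℕ → ℝ
  | 0 => 1
  | r + 1 => 1 + C * KK C r

lemma KK_pos {C : ℝ} (hC : 0 ≤ C) (r : ℕ) : 1 ≤ KK C r := by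
  induction r with
  | zero => simp [KK]
  | succ r ih => simp only [KK]; nlinarith

lemma inball_le (h0 : ∀ d, 0 ≤ ω d) (h1 : ∑ d, ω d = 1) {e : D} (he : S e = ∅) {p C : ℝ}
    (hp0 : 0 ≤ p)
    (hp : ∀ w, ∑ d, ω d * ind (w ∈ S d) ≤ p) (hC : (Fintype.card V : ℝ) * p ≤ C)
    (hC0 : 0 ≤ C) (z : V) (r : ℕ) :
    ∑ u, Ex ω (fun x => ind (z ∈ ball S x r u)) ≤ KK C r := by
  induction r with
  | zero =>
    simp only [ball, mem_singleton, KK, Ex_const h1]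
    rw [Finset.sum_eq_single z]
    · exact ind_le_one _
    · intro b _ hb; exact ind_false (Ne.symm hb)
    · simp
  | succ r ih =>
    have step : ∀ u, Ex ω (fun x => ind (z ∈ ball S x (r+1) u)) ≤
        ind (z = u) + p * ∑ w, Ex ω (fun x => ind (z ∈ ball S x r w)) := by
      intro u
      have h2 : ∀ x : V → D, ind (z ∈ ball S x (r+1) u) ≤
          ind (z = u) + ∑ w, ind (w ∈ S (x u)) *
            ind (z ∈ ball S (Function.update x u e) r w) := by
        intro x
        have : z ∈ ball S x (r+1) u → z = u ∨ ∃ w ∈ univ, (w ∈ S (x u) ∧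
            z ∈ ball S (Function.update x u e) r w) := by
          intro h
          simp only [ball, mem_insert, mem_biUnion] at h
          rcases h with h | ⟨w, hw, hz⟩
          · exact Or.inl h
          · rcases ball_avoid e x u z r w hz with h3 | h3 | ⟨y, hy, h3⟩
            · exact Or.inr ⟨w, mem_univ _, hw, h3⟩
            · exact Or.inl h3
            · exact Or.inr ⟨y, mem_univ _, hy, h3⟩
        refine (ind_mono this).trans ((ind_or_le _ _).trans ?_)
        gcongr
        refine (ind_exists_le _ _).trans (le_of_eq ?_)
        exact Finset.sum_congr rfl fun w _ => ind_and _ _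
      refine (Ex_mono h0 h2).trans ?_
      rw [Ex_add, Ex_const h1, Ex_sum, Finset.mul_sum]
      gcongr with w _
      rw [Ex_row_indep h1 u (fun d => ind (w ∈ S d))
        (fun x => ind (z ∈ ball S (Function.update x u e) r w))
        (by intro x d; rw [Function.update_idem])]
      refine mul_le_mul (hp w) ?_ (Ex_nonneg h0 fun _ => ind_nonneg _) hp0
      exact Ex_mono h0 fun x => ind_mono fun h => ball_update_subset he x u r w h
    calc _ ≤ ∑ u, (ind (z = u) + p * ∑ w, Ex ω (fun x => ind (z ∈ ball S x r w))) :=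
          Finset.sum_le_sum fun u _ => step u
      _ ≤ ∑ u, (ind (z = u) + p * KK C r) := by gcongr
      _ = 1 + (Fintype.card V : ℝ) * p * KK C r := by
          rw [Finset.sum_add_distrib, Finset.sum_const, Finset.card_univ, nsmul_eq_mul]
          have : ∑ u, ind (z = u) = 1 := by
            rw [Finset.sum_eq_single z]
            · exact ind_true rfl
            · intro b _ hb; exact ind_false (Ne.symm hb)
            · simp
          rw [this]; ring
      _ ≤ KK C (r+1) := by
          simp only [KK]
          gcongr
          exact (zero_le_one.trans (KK_pos hC0 r))

end abs
end WLA

namespace WLA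
open Finset

section lln
variable {V D : Type*} [Fintype V] [DecidableEq V] [Fintype D]
variable {ω : D → ℝ} {S : D → Finset V}

/-- `f` depends on `x` only through the ball of radius `r` around `u`. -/
def LocalAt {β : Type*} (S : D → Finset V) (r : ℕ) (u : V) (f : (V → D) → β) : Prop :=
  ∀ x y, (∀ v ∈ ball S x r u, y v = x v) → f y = f x

lemma Ex_mul_right (a : ℝ) (F : (V → D) → ℝ) : Ex ω (fun x => F x * a) = Ex ω F * a := by
  simp only [mul_comm _ a]; exact Ex_mul_left a F

lemma cov_le (h0 : ∀ d, 0 ≤ ω d) (h1 : ∑ d, ω d = 1) {r : ℕ} {u u' : V}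
    {f g : (V → D) → ℝ} (hf : LocalAt S r u f) (hg : LocalAt S r u' g) {M : ℝ}
    (hfM : ∀ x, |f x| ≤ M) (hgM : ∀ x, |g x| ≤ M) :
    Ex ω (fun x => f x * g x) ≤ Ex ω f * Ex ω g + 2 * M ^ 2 *
      ∑ z, Ex ω (fun x => ind (z ∈ ball S x r u)) * Ex ω (fun x => ind (z ∈ ball S x r u')) := by
  have hM : 0 ≤ M := by
    by_contra hneg
    push Not at hneg
    have hD : Nonempty D := by
      by_contra hne
      rw [not_nonempty_iff] at hne
      simp at h1
    obtain ⟨d⟩ := hD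
    have := (abs_nonneg _).trans (hfM (fun _ => d))
    linarith
  rw [Ex_mix h1 (fun y => ball S y r u) (fun x y h => ball_local r x y u h)]
  have pt : ∀ y y' : V → D, f (mix (ball S y r u) y y') * g (mix (ball S y r u) y y') ≤
      f y * g y' + 2 * M ^ 2 * ∑ z, ind (z ∈ ball S y r u) * ind (z ∈ ball S y' r u') := by
    intro y y'
    have e1 : f (mix (ball S y r u) y y') = f y := hf _ _ fun v hv => by simp [mix, hv]
    rw [e1]
    have hs : 0 ≤ ∑ z, ind (z ∈ ball S y r u) * ind (z ∈ ball S y' r u') :=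
      Finset.sum_nonneg fun z _ => mul_nonneg (ind_nonneg _) (ind_nonneg _)
    by_cases hz : ∃ z, z ∈ ball S y r u ∧ z ∈ ball S y' r u'
    · obtain ⟨z, hz1, hz2⟩ := hz
      have h3 : (1:ℝ) ≤ ∑ z, ind (z ∈ ball S y r u) * ind (z ∈ ball S y' r u') := by
        have := Finset.single_le_sum (s := univ)
          (f := fun z => ind (z ∈ ball S y r u) * ind (z ∈ ball S y' r u'))
          (fun z _ => mul_nonneg (ind_nonneg _) (ind_nonneg _)) (mem_univ z)
        simpa [ind_true hz1, ind_true hz2] using this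
      have h4 : f y * g (mix (ball S y r u) y y') ≤ M * M := by
        refine (le_abs_self _).trans ?_
        rw [abs_mul]
        exact mul_le_mul (hfM _) (hgM _) (abs_nonneg _) hM
      have h5 : -(M * M) ≤ f y * g y' := by
        refine le_trans (neg_le_neg ?_) (neg_abs_le _)
        rw [abs_mul]
        exact mul_le_mul (hfM _) (hgM _) (abs_nonneg _) hM
      nlinarith [mul_le_mul_of_nonneg_left h3 (by positivity : 0 ≤ 2 * M ^ 2)]
    · push Not at hz
      have e2 : g (mix (ball S y r u) y y') = g y' := hg _ _ fun v hv => by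
        have : v ∉ ball S y r u := fun h => hz v h hv
        simp [mix, this]
      rw [e2]
      nlinarith [mul_nonneg (by positivity : 0 ≤ 2 * M ^ 2) hs]
  refine (Ex_mono h0 fun y => Ex_mono h0 fun y' => pt y y').trans (le_of_eq ?_)
  simp only [Ex_add, Ex_mul_left, Ex_sum, Ex_mul_right]

lemma var_le (h0 : ∀ d, 0 ≤ ω d) (h1 : ∑ d, ω d = 1) {e : D} (he : S e = ∅) {p C : ℝ}
    (hp0 : 0 ≤ p)
    (hp : ∀ w, ∑ d, ω d * ind (w ∈ S d) ≤ p) (hC : (Fintype.card V : ℝ) * p ≤ C)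
    (hC0 : 0 ≤ C) {r : ℕ} {f : V → (V → D) → ℝ} (hf : ∀ u, LocalAt S r u (f u)) {M : ℝ}
    (hfM : ∀ u x, |f u x| ≤ M) :
    Ex ω (fun x => (∑ u, f u x - ∑ u, Ex ω (f u)) ^ 2) ≤
      2 * M ^ 2 * KK C r ^ 2 * Fintype.card V := by
  set m := ∑ u, Ex ω (f u) with hm
  have e1 : Ex ω (fun x => (∑ u, f u x - m) ^ 2) =
      ∑ u, ∑ u', Ex ω (fun x => f u x * f u' x) - m ^ 2 := by
    have : ∀ x : V → D, (∑ u, f u x - m) ^ 2 =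
        (∑ u, ∑ u', f u x * f u' x) - 2 * m * ∑ u, f u x + m ^ 2 := by
      intro x
      rw [← Finset.sum_mul_sum]; ring
    simp only [this, Ex_add, Ex_sub, Ex_mul_left, Ex_sum, Ex_const h1]
    rw [← hm]; ring
  rw [e1]
  have e2 : ∑ u, ∑ u', Ex ω (fun x => f u x * f u' x) ≤ ∑ u, ∑ u', (Ex ω (f u) * Ex ω (f u') +
      2 * M ^ 2 *
      ∑ z, Ex ω (fun x => ind (z ∈ ball S x r u)) * Ex ω (fun x => ind (z ∈ ball S x r u'))) :=
    Finset.sum_le_sum fun u _ => Finset.sum_le_sum fun u' _ =>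
      cov_le h0 h1 (hf u) (hf u') (hfM u) (hfM u')
  have e3 : ∑ u, ∑ u', (Ex ω (f u) * Ex ω (f u') + 2 * M ^ 2 *
      ∑ z, Ex ω (fun x => ind (z ∈ ball S x r u)) * Ex ω (fun x => ind (z ∈ ball S x r u'))) =
      m ^ 2 + 2 * M ^ 2 * ∑ z, (∑ u, Ex ω (fun x => ind (z ∈ ball S x r u))) ^ 2 := by
    simp only [Finset.sum_add_distrib, ← Finset.mul_sum]
    congr 1
    · rw [← Finset.sum_mul, hm]; ring
    · congr 1
      simp only [pow_two, Finset.sum_mul_sum]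
      rw [Finset.sum_comm' (t' := univ) (s' := fun _ => univ) (by simp)]
      rw [Finset.sum_comm]
      rw [Finset.sum_comm]
      conv_rhs => rw [Finset.sum_comm]
      rw [Finset.sum_comm]
      refine Finset.sum_congr rfl fun u _ => ?_
      rw [Finset.sum_comm]
  have e4 : ∑ z, (∑ u, Ex ω (fun x => ind (z ∈ ball S x r u))) ^ 2 ≤
      ∑ z : V, KK C r ^ 2 := by
    refine Finset.sum_le_sum fun z _ => ?_
    refine pow_le_pow_left₀ (Finset.sum_nonneg fun u _ => Ex_nonneg h0 fun _ => ind_nonneg _) ?_ 2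
    exact inball_le h0 h1 he hp0 hp hC hC0 z r
  rw [Finset.sum_const, Finset.card_univ, nsmul_eq_mul] at e4
  have := mul_le_mul_of_nonneg_left e4 (by positivity : 0 ≤ 2 * M ^ 2)
  rw [e3] at e2
  linarith

/-- Chebyshev. -/
lemma Ex_cheb (h0 : ∀ d, 0 ≤ ω d) {F : (V → D) → ℝ} {t Q : ℝ} (ht : 0 < t)
    (hQ : Ex ω (fun x => F x ^ 2) ≤ Q) :
    Ex ω (fun x => ind (t ≤ F x)) ≤ Q / t ^ 2 := by
  have : ∀ x : V → D, ind (t ≤ F x) ≤ (1 / t ^ 2) * F x ^ 2 := by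
    intro x
    have h := ind_le_div (sq_nonneg (F x)) (pow_pos ht 2)
    refine le_trans (ind_mono fun h => ?_) (h.trans (le_of_eq (by ring)))
    exact pow_le_pow_left₀ ht.le h 2
  refine (Ex_mono h0 this).trans ?_
  rw [Ex_mul_left]
  rw [one_div, inv_mul_eq_div]
  gcongr

lemma lln (h0 : ∀ d, 0 ≤ ω d) (h1 : ∑ d, ω d = 1) {e : D} (he : S e = ∅) {p C : ℝ}
    (hp0 : 0 ≤ p)
    (hp : ∀ w, ∑ d, ω d * ind (w ∈ S d) ≤ p) (hC : (Fintype.card V : ℝ) * p ≤ C)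
    (hC0 : 0 ≤ C) {r : ℕ} {f : V → (V → D) → ℝ} (hf : ∀ u, LocalAt S r u (f u)) {M : ℝ}
    (hfM : ∀ u x, |f u x| ≤ M) {t : ℝ} (ht : 0 < t) :
    Ex ω (fun x => ind (∑ u, Ex ω (f u) + t ≤ ∑ u, f u x)) ≤
      2 * M ^ 2 * KK C r ^ 2 * Fintype.card V / t ^ 2 := by
  refine le_trans (le_of_eq ?_) (Ex_cheb h0 ht (var_le h0 h1 he hp0 hp hC hC0 hf hfM))
  congr 1; funext x
  exact ind_congr ⟨fun h => by linarith, fun h => by linarith⟩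

lemma LocalAt.mono {β : Type*} {r : ℕ} {u : V} {f : (V → D) → β} (h : LocalAt S r u f) :
    LocalAt S (r + 1) u f := fun x y hxy => h x y fun v hv => hxy v (ball_mono_succ _ _ _ hv)

end lln
end WLA

namespace WLA
open Finset

/-- Vertex data: a default colour and the raw row of the adjacency matrix. -/
abbrev DD (n : ℕ) := Fin 3 × (Fin n → Bool)

/-- Bernoulli weights. -/
noncomputable def bw (p : ℝ) (b : Bool) : ℝ := if b = true then p else 1 - p

noncomputable def om (n : ℕ) (p : ℝ) (d : DD n) : ℝ := (1 / 3) * wt (bw p) d.2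

def Sr {n : ℕ} (R : Fin n → Bool) : Finset (Fin n) := univ.filter fun w => R w = true

def Sd {n : ℕ} (d : DD n) : Finset (Fin n) := Sr d.2

def e0 (n : ℕ) : DD n := (0, fun _ => false)

lemma mem_Sr {n : ℕ} {R : Fin n → Bool} {w : Fin n} : w ∈ Sr R ↔ R w = true := by simp [Sr]
lemma mem_Sd {n : ℕ} {d : DD n} {w : Fin n} : w ∈ Sd d ↔ d.2 w = true := by simp [Sd, Sr]

lemma Sd_e0 (n : ℕ) : Sd (e0 n) = ∅ := by simp [Sd, Sr, e0]

lemma bw_nonneg {p : ℝ} (h0 : 0 ≤ p) (h1 : p ≤ 1) (b : Bool) : 0 ≤ bw p b := by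
  unfold bw; split_ifs <;> linarith

lemma bw_sum (p : ℝ) : ∑ b, bw p b = 1 := by simp [bw]

lemma om_nonneg {n : ℕ} {p : ℝ} (h0 : 0 ≤ p) (h1 : p ≤ 1) (d : DD n) : 0 ≤ om n p d :=
  mul_nonneg (by norm_num) (wt_nonneg (bw_nonneg h0 h1) _)

/-- Sum over vertex data. -/
lemma om_sum_eq {n : ℕ} (p : ℝ) (F : DD n → ℝ) :
    ∑ d, om n p d * F d = (1 / 3) * ∑ a : Fin 3, Ex (bw p) (fun R => F (a, R)) := by
  rw [Fintype.sum_prod_type, Finset.mul_sum]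
  refine Finset.sum_congr rfl fun a _ => ?_
  unfold Ex om
  rw [Finset.mul_sum]
  exact Finset.sum_congr rfl fun R _ => by ring

lemma om_sum (n : ℕ) (p : ℝ) : ∑ d, om n p d = 1 := by
  have := om_sum_eq (n := n) p (fun _ => 1)
  simp only [mul_one] at this
  rw [this]
  simp [Ex_const (bw_sum p)]

lemma Ex_bw_mem {n : ℕ} (p : ℝ) (w : Fin n) : Ex (bw p) (fun R => ind (w ∈ Sr R)) = p := by
  have := Ex_row_indep (ω := bw p) (bw_sum p) w (fun b => ind (b = true)) (fun _ => 1)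
    (by intros; rfl)
  simp only [mul_one, Ex_const (bw_sum p)] at this
  simp only [mem_Sr]
  rw [this]
  simp [bw, ind]

lemma om_mem {n : ℕ} (p : ℝ) (w : Fin n) : ∑ d, om n p d * ind (w ∈ Sd d) = p := by
  rw [om_sum_eq]
  simp only [Sd]
  simp [Ex_bw_mem]

def cnt {n : ℕ} (d : DD n) (c : Fin n → Fin 3) (a : Fin 3) : ℕ := #{w ∈ Sd d | c w = a}

def rule {n : ℕ} (d : DD n) (c : Fin n → Fin 3) : Fin 3 :=
  if (Sd d).card < 2 * cnt d c d.1 then d.1 + 1 else d.1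

lemma fin3_succ_ne (a : Fin 3) : a + 1 ≠ a := by revert a; decide

lemma cnt_add_le {n : ℕ} (d : DD n) (c : Fin n → Fin 3) {a b : Fin 3} (hab : a ≠ b) :
    cnt d c a + cnt d c b ≤ (Sd d).card := by
  unfold cnt
  rw [← Finset.card_union_of_disjoint]
  · exact Finset.card_le_card (Finset.union_subset (Finset.filter_subset _ _)
      (Finset.filter_subset _ _))
  · rw [Finset.disjoint_filter]
    intro w _ h1 h2
    exact hab (h1.symm.trans h2)

lemma rule_valid {n : ℕ} (d : DD n) (c : Fin n → Fin 3) :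
    2 * cnt d c (rule d c) ≤ (Sd d).card := by
  unfold rule
  split_ifs with h
  · have := cnt_add_le d c (fin3_succ_ne d.1)
    omega
  · omega

lemma cnt_congr {n : ℕ} (d : DD n) {c c' : Fin n → Fin 3} (h : ∀ w ∈ Sd d, c w = c' w)
    (a : Fin 3) : cnt d c a = cnt d c' a := by
  unfold cnt
  congr 1
  refine Finset.filter_congr fun w hw => by rw [h w hw]

lemma rule_congr {n : ℕ} (d : DD n) {c c' : Fin n → Fin 3} (h : ∀ w ∈ Sd d, c w = c' w) :
    rule d c = rule d c' := by
  unfold rule; rw [cnt_congr d h]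

def col {n : ℕ} (x : Fin n → DD n) : ℕ → Fin n → Fin 3
  | 0, v => (x v).1
  | t + 1, v => rule (x v) (col x t)

lemma col_local {n : ℕ} (t : ℕ) (u : Fin n) : LocalAt Sd t u (fun x => col x t u) := by
  induction t generalizing u with
  | zero => intro x y h; simp only [col]; rw [h u (self_mem_ball _ _ _)]
  | succ t ih =>
    intro x y h
    simp only [col]
    rw [h u (self_mem_ball _ _ _)]
    refine rule_congr _ fun w hw => ih w x y fun v hv => h v (ball_succ_of_mem hw hv)

lemma cnt_shift {n : ℕ} (a s : Fin 3) (R : Fin n → Bool) (c : Fin n → Fin 3) (b : Fin 3) :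
    cnt (a + s, R) (fun w => c w + s) (b + s) = cnt (a, R) c b := by
  unfold cnt Sd
  simp

lemma rule_shift {n : ℕ} (a s : Fin 3) (R : Fin n → Bool) (c : Fin n → Fin 3) :
    rule (a + s, R) (fun w => c w + s) = rule (a, R) c + s := by
  unfold rule
  simp only [cnt_shift]
  have : (Sd ((a + s, R) : DD n)) = Sd (a, R) := rfl
  rw [this]
  split_ifs
  · abel
  · rfl

def shiftc {n : ℕ} (s : Fin 3) (x : Fin n → DD n) : Fin n → DD n :=
  fun v => ((x v).1 + s, (x v).2)

lemma col_shift {n : ℕ} (s : Fin 3) (x : Fin n → DD n) (t : ℕ) :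
    col (shiftc s x) t = fun v => col x t v + s := by
  induction t with
  | zero => rfl
  | succ t ih =>
    funext v
    simp only [col, ih]
    exact rule_shift _ _ _ _

lemma Ex_shift {n : ℕ} (p : ℝ) (s : Fin 3) (F : (Fin n → DD n) → ℝ) :
    Ex (om n p) (fun x => F (shiftc s x)) = Ex (om n p) F := by
  unfold Ex
  refine Finset.sum_bij' (fun x _ => shiftc s x) (fun x _ => shiftc (-s) x) ?_ ?_ ?_ ?_ ?_
  · simp
  · simp
  · intro x _; funext v; simp [shiftc]
  · intro x _; funext v; simp [shiftc]
  · intro x _; rfl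

lemma sum_ind_eq (b : Fin 3) : ∑ a : Fin 3, ind (b = a) = 1 := by
  rw [Finset.sum_eq_single b]
  · exact ind_true rfl
  · intro a _ h; exact ind_false h.symm
  · simp

lemma Ex_col {n : ℕ} (p : ℝ) (t : ℕ) (u : Fin n) (a : Fin 3) :
    Ex (om n p) (fun x => ind (col x t u = a)) = 1 / 3 := by
  have h1 : ∀ a s : Fin 3, Ex (om n p) (fun x => ind (col x t u = a)) =
      Ex (om n p) (fun x => ind (col x t u = a + s)) := by
    intro a s
    rw [← Ex_shift p s (fun x => ind (col x t u = a + s))]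
    simp only [col_shift]
    congr 1; funext x
    exact ind_congr (by simp)
  have h2 : ∑ b : Fin 3, Ex (om n p) (fun x => ind (col x t u = b)) = 1 := by
    rw [← Ex_sum]
    simp only [sum_ind_eq]
    exact Ex_const (om_sum n p) 1
  have h3 : ∀ b, Ex (om n p) (fun x => ind (col x t u = b)) =
      Ex (om n p) (fun x => ind (col x t u = a)) := by
    intro b
    rw [h1 b (a - b)]; simp
  simp only [h3] at h2
  simp at h2
  linarith

/-- Balanced colourings. -/
def Bal {n : ℕ} (c : Fin n → Fin 3) : Prop :=
  ∀ a, (#{u | c u = a} : ℝ) ≤ 0.3354 * n ∧ (#{u | c u ≠ a} : ℝ) ≤ 0.6687 * n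

lemma Ex_not_bal {n : ℕ} (hn : 0 < n) {p C : ℝ} (hp0 : 0 ≤ p) (hp1 : p ≤ 1)
    (hC : (n : ℝ) * p ≤ C) (hC0 : 0 ≤ C) {r : ℕ} {g : Fin n → (Fin n → DD n) → Fin 3}
    (hg : ∀ u, LocalAt Sd r u (g u))
    (hgE : ∀ u a, Ex (om n p) (fun x => ind (g u x = a)) = 1 / 3) :
    Ex (om n p) (fun x => ind (¬ Bal (fun u => g u x))) ≤ 3000000 * KK C r ^ 2 / n := by
  have h0 := om_nonneg (n := n) hp0 hp1
  have h1 := om_sum n p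
  have hn' : (0:ℝ) < n := by exact_mod_cast hn
  have ht : 0 < (0.002 : ℝ) * n := by positivity
  have hCc : (Fintype.card (Fin n) : ℝ) * p ≤ C := by simpa using hC
  have A : ∀ a, Ex (om n p) (fun x => ind (∑ u, Ex (om n p) (fun x => ind (g u x = a)) +
      0.002 * n ≤ ∑ u, ind (g u x = a))) ≤ 2 * 1 ^ 2 * KK C r ^ 2 * n / (0.002 * n) ^ 2 := by
    intro a
    have := lln (f := fun u x => ind (g u x = a)) h0 h1 (Sd_e0 n) hp0 (fun w => (om_mem p w).le)
      hCc hC0 (r := r) (M := 1) (fun u x y h => by simp only [hg u x y h])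
      (fun u x => by rw [abs_of_nonneg (ind_nonneg _)]; exact ind_le_one _) ht
    simpa using this
  have B : ∀ a, Ex (om n p) (fun x => ind (∑ u, Ex (om n p) (fun x => ind (g u x ≠ a)) +
      0.002 * n ≤ ∑ u, ind (g u x ≠ a))) ≤ 2 * 1 ^ 2 * KK C r ^ 2 * n / (0.002 * n) ^ 2 := by
    intro a
    have := lln (f := fun u x => ind (g u x ≠ a)) h0 h1 (Sd_e0 n) hp0 (fun w => (om_mem p w).le)
      hCc hC0 (r := r) (M := 1) (fun u x y h => by simp only [hg u x y h])
      (fun u x => by rw [abs_of_nonneg (ind_nonneg _)]; exact ind_le_one _) ht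
    simpa using this
  have hE2 : ∀ u a, Ex (om n p) (fun x => ind (g u x ≠ a)) = 2 / 3 := by
    intro u a
    simp only [ne_eq, ind_not, Ex_sub, Ex_const h1, hgE]; norm_num
  simp only [hgE, hE2, Finset.sum_const, Finset.card_univ, Fintype.card_fin, nsmul_eq_mul] at A B
  have pt : ∀ x, ind (¬ Bal (fun u => g u x)) ≤ ∑ a : Fin 3,
      (ind ((n:ℝ) * (1 / 3) + 0.002 * n ≤ ∑ u, ind (g u x = a)) +
       ind ((n:ℝ) * (2 / 3) + 0.002 * n ≤ ∑ u, ind (g u x ≠ a))) := by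
    intro x
    have : ¬ Bal (fun u => g u x) → ∃ a ∈ (univ : Finset (Fin 3)),
        ((n:ℝ) * (1 / 3) + 0.002 * n ≤ ∑ u, ind (g u x = a)) ∨
       ((n:ℝ) * (2 / 3) + 0.002 * n ≤ ∑ u, ind (g u x ≠ a)) := by
      intro h
      unfold Bal at h
      push Not at h
      obtain ⟨a, ha⟩ := h
      refine ⟨a, mem_univ _, ?_⟩
      by_contra hcon
      push Not at hcon
      have e1 := card_filter_eq_sum_ind univ (fun u => g u x = a)
      have e2 := card_filter_eq_sum_ind univ (fun u => g u x ≠ a)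
      have := ha (by rw [e1]; linarith [hcon.1])
      rw [e2] at this
      linarith [hcon.2]
    refine (ind_mono this).trans ((ind_exists_le _ _).trans ?_)
    exact Finset.sum_le_sum fun a _ => ind_or_le _ _
  refine (Ex_mono h0 pt).trans ?_
  rw [Ex_sum]
  simp only [Ex_add]
  refine (Finset.sum_le_sum fun a _ => add_le_add (A a) (B a)).trans (le_of_eq ?_)
  simp only [Finset.sum_const, Finset.card_univ, Fintype.card_fin, nsmul_eq_mul]
  field_simp
  norm_num
  ring

end WLA

namespace WLA
open Finset

lemma wt_bw {n : ℕ} (p : ℝ) (R : Fin n → Bool) :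
    wt (bw p) R = p ^ (Sr R).card * (1 - p) ^ (n - (Sr R).card) := by
  unfold wt bw
  rw [Finset.prod_ite]
  simp only [Finset.prod_const]
  congr 2
  have := Finset.card_filter_add_card_filter_not (s := (univ : Finset (Fin n))) (fun w => R w = true)
  simp only [Finset.card_univ, Fintype.card_fin] at this
  unfold Sr
  omega

lemma Ex_Sr_eq {n : ℕ} (p : ℝ) (T : Finset (Fin n)) :
    Ex (bw p) (fun R => ind (Sr R = T)) = p ^ T.card * (1 - p) ^ (n - T.card) := by
  unfold Ex
  have hT : Sr (fun w => decide (w ∈ T)) = T := by ext w; simp [mem_Sr]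
  rw [Finset.sum_eq_single (fun w => decide (w ∈ T))]
  · beta_reduce
    rw [hT, ind_true rfl, wt_bw, hT, mul_one]
  · intro R _ hR
    beta_reduce
    rw [ind_false, mul_zero]
    intro h
    apply hR
    funext w
    rw [← h]
    simp [mem_Sr]
  · simp

/-- Event that `w` is in the row, everything else in `A ∪ A'`, with given counts. -/
def Ev {n : ℕ} (w : Fin n) (A A' : Finset (Fin n)) (i j : ℕ) (R : Fin n → Bool) : Prop :=
  w ∈ Sr R ∧ (Sr R).erase w ⊆ A ∪ A' ∧ (Sr R ∩ A).card = i ∧ (Sr R ∩ A').card = j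

lemma count_le {n : ℕ} {p : ℝ} (hp0 : 0 ≤ p) (hp1 : p ≤ 1) (w : Fin n) {A A' : Finset (Fin n)}
    (hw : w ∉ A) (hw' : w ∉ A') (hd : Disjoint A A') (i j : ℕ) :
    Ex (bw p) (fun R => ind (Ev w A A' i j R)) ≤
      A.card.choose i * A'.card.choose j * (p ^ (i + j + 1) * (1 - p) ^ (n - (i + j + 1))) := by
  have pt : ∀ R : Fin n → Bool, ind (Ev w A A' i j R) ≤
      ∑ T ∈ A.powersetCard i ×ˢ A'.powersetCard j, ind (Sr R = insert w (T.1 ∪ T.2)) := by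
    intro R
    refine le_trans (ind_mono ?_) (ind_exists_le _ _)
    rintro ⟨h1, h2, h3, h4⟩
    refine ⟨(Sr R ∩ A, Sr R ∩ A'), ?_, ?_⟩
    · simp [Finset.mem_powersetCard, h3, h4, Finset.inter_subset_right]
    · ext u
      simp only [mem_insert, mem_union, mem_inter]
      constructor
      · intro hu
        by_cases huw : u = w
        · exact Or.inl huw
        · have := h2 (Finset.mem_erase.2 ⟨huw, hu⟩)
          rw [mem_union] at this
          tauto
      · rintro (rfl | h | h)
        · exact h1
        · exact h.1
        · exact h.1
  refine (Ex_mono (bw_nonneg hp0 hp1) pt).trans ?_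
  rw [Ex_sum]
  rw [Finset.sum_congr rfl (g := fun _ => p ^ (i + j + 1) * (1 - p) ^ (n - (i + j + 1)))]
  · rw [Finset.sum_const, Finset.card_product, Finset.card_powersetCard,
      Finset.card_powersetCard, nsmul_eq_mul]
    push_cast; rfl
  · rintro ⟨T, T'⟩ hT
    simp only [Finset.mem_product, Finset.mem_powersetCard] at hT
    have : (insert w (T ∪ T')).card = i + j + 1 := by
      rw [Finset.card_insert_of_notMem, Finset.card_union_of_disjoint, hT.1.2, hT.2.2]
      · exact Finset.disjoint_of_subset_left hT.1.1 (Finset.disjoint_of_subset_right hT.2.1 hd)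
      · rw [mem_union]; rintro (h | h)
        · exact hw (hT.1.1 h)
        · exact hw' (hT.2.1 h)
    rw [Ex_Sr_eq, this]

lemma choose_le_real (m i : ℕ) {b : ℝ} (h : (m : ℝ) ≤ b) : (m.choose i : ℝ) ≤ b ^ i / i.factorial := by
  refine (Nat.choose_le_pow_div i m).trans ?_
  gcongr

/-- Odds parameter. -/
noncomputable def Lp (n : ℕ) (p : ℝ) : ℝ := n * p / (1 - p)

lemma count_real {n : ℕ} {p : ℝ} (hp0 : 0 ≤ p) (hp1 : p < 1) (w : Fin n) {A A' : Finset (Fin n)}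
    (hw : w ∉ A) (hw' : w ∉ A') (hd : Disjoint A A') (i j : ℕ) {α α' : ℝ}
    (hα : (A.card : ℝ) ≤ α * n) (hα' : (A'.card : ℝ) ≤ α' * n) (hα0 : 0 ≤ α) (hα0' : 0 ≤ α') :
    n * Ex (bw p) (fun R => ind (Ev w A A' i j R)) ≤
      (1 - p) ^ n * (Lp n p ^ (i + j + 1) * (α ^ i * α' ^ j / (i.factorial * j.factorial))) := by
  have hq : 0 < 1 - p := by linarith
  have hn0 : (0:ℝ) ≤ n := Nat.cast_nonneg n
  have hL : 0 ≤ Lp n p := by unfold Lp; positivity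
  refine (mul_le_mul_of_nonneg_left (count_le hp0 hp1.le w hw hw' hd i j) hn0).trans ?_
  by_cases hk : i + j + 1 ≤ n
  · have e : p ^ (i + j + 1) * (1 - p) ^ (n - (i + j + 1)) =
        (1 - p) ^ n * (p / (1 - p)) ^ (i + j + 1) := by
      conv_rhs => rw [← Nat.sub_add_cancel hk, pow_add (1 - p) (n - (i + j + 1)) (i + j + 1)]
      rw [div_pow]
      have := (pow_pos hq (i + j + 1)).ne'
      field_simp
    rw [e]
    have c1 := choose_le_real A.card i hα
    have c2 := choose_le_real A'.card j hα'
    calc _ ≤ (n:ℝ) * ((α * n) ^ i / i.factorial * ((α' * n) ^ j / j.factorial) *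
          ((1 - p) ^ n * (p / (1 - p)) ^ (i + j + 1))) := by gcongr
      _ = _ := by
        unfold Lp
        rw [mul_div_assoc, mul_pow (n:ℝ) (p / (1 - p))]
        rw [pow_succ (n:ℝ), pow_add (n:ℝ), mul_pow, mul_pow]
        field_simp
  · have : A.card.choose i = 0 ∨ A'.card.choose j = 0 := by
      rw [Nat.choose_eq_zero_iff, Nat.choose_eq_zero_iff]
      have h1 : (insert w (A ∪ A')).card ≤ n := by
        simpa using Finset.card_le_univ (insert w (A ∪ A'))
      rw [Finset.card_insert_of_notMem (by simp [hw, hw']), Finset.card_union_of_disjoint hd] at h1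
      omega
    have z : (A.card.choose i : ℝ) * A'.card.choose j = 0 := by
      rcases this with h | h <;> simp [h]
    rw [z]; simp only [zero_mul, mul_zero]
    positivity

/-- Pivot event for colour `a` at `w`. -/
def Piv {n : ℕ} (c : Fin n → Fin 3) (a : Fin 3) (w : Fin n) (R : Fin n → Bool) : Prop :=
  w ∈ Sr R ∧ #{u ∈ (Sr R).erase w | c u ≠ a} ≤ #{u ∈ (Sr R).erase w | c u = a} ∧
    #{u ∈ (Sr R).erase w | c u = a} ≤ #{u ∈ (Sr R).erase w | c u ≠ a} + 1

/-- Second pivot event. -/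
def Piv2 {n : ℕ} (c : Fin n → Fin 3) (a : Fin 3) (w : Fin n) (R : Fin n → Bool) : Prop :=
  w ∈ Sr R ∧ (∀ u ∈ (Sr R).erase w, c u = a ∨ c u = a + 1) ∧
    #{u ∈ (Sr R).erase w | c u = a} = #{u ∈ (Sr R).erase w | c u = a + 1}

/-- Explicit series bounds. -/
noncomputable def B1 (n : ℕ) (p : ℝ) : ℝ := (1 - p) ^ n * ∑ j ∈ range n,
  (Lp n p ^ (j + j + 1) * (0.3354 ^ j * 0.6687 ^ j / (j.factorial * j.factorial)) +
   Lp n p ^ (j + 1 + j + 1) * (0.3354 ^ (j + 1) * 0.6687 ^ j / ((j + 1).factorial * j.factorial)))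

noncomputable def B2 (n : ℕ) (p : ℝ) : ℝ := (1 - p) ^ n * ∑ j ∈ range n,
  Lp n p ^ (j + j + 1) * (0.3354 ^ j * 0.3354 ^ j / (j.factorial * j.factorial))

lemma inter_erase_filter {n : ℕ} (S : Finset (Fin n)) (w : Fin n) (P : Fin n → Prop)
    [DecidablePred P] : S ∩ ((univ.filter P).erase w) = (S.erase w).filter P := by
  ext u; simp; tauto

lemma card_erase_le_lt {n : ℕ} (S : Finset (Fin n)) (w : Fin n) (P : Fin n → Prop)
    [DecidablePred P] : ((S.erase w).filter P).card < n := by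
  have h1 : ((S.erase w).filter P).card ≤ ((univ : Finset (Fin n)).erase w).card :=
    Finset.card_le_card fun u hu => by
      simp only [mem_filter, mem_erase] at hu
      exact Finset.mem_erase.2 ⟨hu.1.1, mem_univ _⟩
  rw [Finset.card_erase_of_mem (mem_univ _), Finset.card_univ, Fintype.card_fin] at h1
  have := w.pos
  omega

lemma piv_le {n : ℕ} {p : ℝ} (hp0 : 0 ≤ p) (hp1 : p < 1) {c : Fin n → Fin 3} (hc : Bal c)
    (a : Fin 3) (w : Fin n) :
    n * Ex (bw p) (fun R => ind (Piv c a w R)) ≤ B1 n p := by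
  set A := ((univ : Finset (Fin n)).filter (fun u => c u = a)).erase w with hA
  set A' := ((univ : Finset (Fin n)).filter (fun u => c u ≠ a)).erase w with hA'
  have hw : w ∉ A := by simp [hA]
  have hw' : w ∉ A' := by simp [hA']
  have hd : Disjoint A A' := by
    rw [Finset.disjoint_left]; intro u h1 h2
    simp [hA, hA'] at h1 h2; tauto
  have hα : (A.card : ℝ) ≤ 0.3354 * n :=
    le_trans (by exact_mod_cast Finset.card_le_card (Finset.erase_subset _ _)) (hc a).1
  have hα' : (A'.card : ℝ) ≤ 0.6687 * n :=
    le_trans (by exact_mod_cast Finset.card_le_card (Finset.erase_subset _ _)) (hc a).2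
  have pt : ∀ R : Fin n → Bool, ind (Piv c a w R) ≤ ∑ j ∈ range n,
      (ind (Ev w A A' j j R) + ind (Ev w A A' (j + 1) j R)) := by
    intro R
    refine le_trans (ind_mono ?_) ((ind_exists_le (range n)
      (fun j => Ev w A A' j j R ∨ Ev w A A' (j + 1) j R)).trans
      (Finset.sum_le_sum fun j _ => ind_or_le _ _))
    rintro ⟨h1, h2, h3⟩
    have hsub : (Sr R).erase w ⊆ A ∪ A' := by
      intro u hu
      simp only [mem_erase] at hu
      simp only [hA, hA', mem_union, mem_erase, mem_filter, mem_univ, true_and]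
      tauto
    refine ⟨#{u ∈ (Sr R).erase w | c u ≠ a}, mem_range.2 (card_erase_le_lt _ _ _), ?_⟩
    unfold Ev
    rw [hA, hA', inter_erase_filter, inter_erase_filter, ← hA, ← hA']
    rcases (by omega : #{u ∈ (Sr R).erase w | c u = a} = #{u ∈ (Sr R).erase w | c u ≠ a} ∨
      #{u ∈ (Sr R).erase w | c u = a} = #{u ∈ (Sr R).erase w | c u ≠ a} + 1) with h | h
    · exact Or.inl ⟨h1, hsub, h, rfl⟩
    · exact Or.inr ⟨h1, hsub, h, rfl⟩
  refine (mul_le_mul_of_nonneg_left (Ex_mono (bw_nonneg hp0 hp1.le) pt) (Nat.cast_nonneg n)).trans ?_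
  rw [Ex_sum, Finset.mul_sum]
  unfold B1
  rw [Finset.mul_sum]
  refine Finset.sum_le_sum fun j _ => ?_
  rw [Ex_add, mul_add, mul_add]
  exact add_le_add
    (count_real hp0 hp1 w hw hw' hd j j hα hα' (by norm_num) (by norm_num))
    (count_real hp0 hp1 w hw hw' hd (j+1) j hα hα' (by norm_num) (by norm_num))

lemma piv2_le {n : ℕ} {p : ℝ} (hp0 : 0 ≤ p) (hp1 : p < 1) {c : Fin n → Fin 3} (hc : Bal c)
    (a : Fin 3) (w : Fin n) :
    n * Ex (bw p) (fun R => ind (Piv2 c a w R)) ≤ B2 n p := by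
  set A := ((univ : Finset (Fin n)).filter (fun u => c u = a)).erase w with hA
  set A' := ((univ : Finset (Fin n)).filter (fun u => c u = a + 1)).erase w with hA'
  have hw : w ∉ A := by simp [hA]
  have hw' : w ∉ A' := by simp [hA']
  have hd : Disjoint A A' := by
    rw [Finset.disjoint_left]; intro u h1 h2
    simp only [hA, hA', mem_erase, mem_filter, mem_univ, true_and] at h1 h2
    exact fin3_succ_ne a (h2.2.symm.trans h1.2)
  have hα : (A.card : ℝ) ≤ 0.3354 * n :=
    le_trans (by exact_mod_cast Finset.card_le_card (Finset.erase_subset _ _)) (hc a).1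
  have hα' : (A'.card : ℝ) ≤ 0.3354 * n :=
    le_trans (by exact_mod_cast Finset.card_le_card (Finset.erase_subset _ _)) (hc (a+1)).1
  have pt : ∀ R : Fin n → Bool, ind (Piv2 c a w R) ≤ ∑ j ∈ range n, ind (Ev w A A' j j R) := by
    intro R
    refine le_trans (ind_mono ?_) (ind_exists_le (range n) (fun j => Ev w A A' j j R))
    rintro ⟨h1, h2, h3⟩
    have hsub : (Sr R).erase w ⊆ A ∪ A' := by
      intro u hu
      have := h2 u hu
      simp only [mem_erase] at hu
      simp only [hA, hA', mem_union, mem_erase, mem_filter, mem_univ, true_and]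
      tauto
    refine ⟨#{u ∈ (Sr R).erase w | c u = a + 1}, mem_range.2 (card_erase_le_lt _ _ _), ?_⟩
    unfold Ev
    rw [hA, hA', inter_erase_filter, inter_erase_filter, ← hA, ← hA']
    exact ⟨h1, hsub, h3, rfl⟩
  refine (mul_le_mul_of_nonneg_left (Ex_mono (bw_nonneg hp0 hp1.le) pt) (Nat.cast_nonneg n)).trans ?_
  rw [Ex_sum, Finset.mul_sum]
  unfold B2
  rw [Finset.mul_sum]
  refine Finset.sum_le_sum fun j _ => ?_
  exact count_real hp0 hp1 w hw hw' hd j j hα hα' (by norm_num) (by norm_num)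

end WLA

namespace WLA
open Finset

noncomputable def GG (β : ℝ) (j : ℕ) : ℝ :=
  ((2 * j + 1).factorial : ℝ) / (j.factorial * j.factorial) * β ^ j

lemma GG_succ (β : ℝ) (j : ℕ) : GG β (j + 1) = GG β j * (2 * (2 * j + 3) / (j + 1) * β) := by
  unfold GG
  have h1 : ((2 * (j + 1) + 1).factorial : ℝ) = (2 * j + 3) * (2 * j + 2) * (2 * j + 1).factorial := by
    rw [show 2 * (j + 1) + 1 = (2 * j + 1) + 1 + 1 by ring, Nat.factorial_succ, Nat.factorial_succ]
    push_cast; ring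
  have h2 : ((j + 1).factorial : ℝ) = (j + 1) * j.factorial := by
    rw [Nat.factorial_succ]; push_cast; ring
  rw [h1, h2, pow_succ]
  have : (j.factorial : ℝ) ≠ 0 := by exact_mod_cast j.factorial_ne_zero
  have h3 : (j : ℝ) + 1 ≠ 0 := by positivity
  field_simp

lemma GG_zero (β : ℝ) : GG β 0 = 1 := by simp [GG]

lemma GG_nonneg {β : ℝ} (h : 0 ≤ β) (j : ℕ) : 0 ≤ GG β j := by unfold GG; positivity

lemma GG_tail {β b : ℝ} (h : 0 ≤ β) (hβ : β ≤ 0.2243) (h4 : GG β 4 ≤ b) (j : ℕ) :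
    GG β (4 + j) ≤ b := by
  induction j with
  | zero => exact h4
  | succ j ih =>
    rw [← add_assoc, GG_succ]
    have : 2 * (2 * ((4 + j : ℕ) : ℝ) + 3) / (((4 + j : ℕ) : ℝ) + 1) * β ≤ 1 := by
      push_cast
      rw [div_mul_eq_mul_div, div_le_one (by positivity)]
      have hj : (0:ℝ) ≤ j := Nat.cast_nonneg j
      nlinarith
    calc _ ≤ GG β (4 + j) * 1 := mul_le_mul_of_nonneg_left this (GG_nonneg h _)
      _ ≤ b := by rw [mul_one]; exact ih

lemma coef (j : ℕ) : (2 / 3) * GG (0.3354 * 0.6687) j + (1 / 3) * GG (0.3354 * 0.3354) j ≤ 1.14 ∧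
    GG (0.3354 * 0.6687) j ≤ 1.6 := by
  have e0 := fun β => GG_zero β
  have e1 := fun β => GG_succ β 0
  have e2 := fun β => GG_succ β 1
  have e3 := fun β => GG_succ β 2
  have e4 := fun β => GG_succ β 3
  norm_num at e1 e2 e3 e4
  rcases (by omega : j = 0 ∨ j = 1 ∨ j = 2 ∨ j = 3 ∨ 4 ≤ j) with h | h | h | h | h
  · subst h; rw [e0, e0]; norm_num
  · subst h; rw [e1, e1, e0, e0]; norm_num
  · subst h; rw [e2, e2, e1, e1, e0, e0]; norm_num
  · subst h; rw [e3, e3, e2, e2, e1, e1, e0, e0]; norm_num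
  · obtain ⟨k, rfl⟩ := Nat.exists_eq_add_of_le h
    have b1 : GG (0.3354 * 0.6687) (4 + k) ≤ 1.6 :=
      GG_tail (by norm_num) (by norm_num) (by rw [e4, e3, e2, e1, e0]; norm_num) k
    have b2 : GG (0.3354 * 0.3354) (4 + k) ≤ 0.2 :=
      GG_tail (by norm_num) (by norm_num) (by rw [e4, e3, e2, e1, e0]; norm_num) k
    exact ⟨by linarith, b1⟩

lemma term1 (L a b : ℝ) (j : ℕ) : L ^ (j + j + 1) * (a ^ j * b ^ j / (j.factorial * j.factorial)) =
    L ^ (2 * j + 1) / (2 * j + 1).factorial * GG (a * b) j := by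
  unfold GG
  have : ((2 * j + 1).factorial : ℝ) ≠ 0 := by exact_mod_cast (2 * j + 1).factorial_ne_zero
  rw [mul_pow, ← two_mul]
  field_simp

lemma term2 (L a b : ℝ) (j : ℕ) :
    L ^ (j + 1 + j + 1) * (a ^ (j + 1) * b ^ j / ((j + 1).factorial * j.factorial)) =
    L ^ (2 * (j + 1)) / (2 * (j + 1)).factorial * (2 * a * GG (a * b) j) := by
  unfold GG
  have h1 : ((2 * (j + 1)).factorial : ℝ) = (2 * j + 2) * (2 * j + 1).factorial := by
    rw [show 2 * (j + 1) = (2 * j + 1) + 1 by ring, Nat.factorial_succ]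
    push_cast; ring
  have h2 : ((j + 1).factorial : ℝ) = (j + 1) * j.factorial := by
    rw [Nat.factorial_succ]; push_cast; ring
  have : ((2 * j + 1).factorial : ℝ) ≠ 0 := by exact_mod_cast (2 * j + 1).factorial_ne_zero
  have h3 : (j : ℝ) + 1 ≠ 0 := by positivity
  have h4 : (j.factorial : ℝ) ≠ 0 := by exact_mod_cast j.factorial_ne_zero
  rw [h1, h2, mul_pow, show j + 1 + j + 1 = 2 * (j + 1) by ring, pow_succ a]
  have h5 : (2:ℝ) * j + 2 ≠ 0 := by positivity
  field_simp

lemma sum_sinh {L : ℝ} (hL : 0 ≤ L) (n : ℕ) :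
    ∑ j ∈ range n, L ^ (2 * j + 1) / (2 * j + 1).factorial ≤ Real.sinh L :=
  sum_le_hasSum _ (fun j _ => by positivity) (Real.hasSum_sinh L)

lemma sum_cosh {L : ℝ} (hL : 0 ≤ L) (n : ℕ) :
    ∑ j ∈ range n, L ^ (2 * (j + 1)) / (2 * (j + 1)).factorial ≤ Real.cosh L - 1 := by
  have := sum_le_hasSum (range (n + 1)) (fun j _ => by positivity) (Real.hasSum_cosh L)
  rw [Finset.sum_range_succ'] at this
  simp at this ⊢
  linarith

lemma B_bound0 {n : ℕ} {p : ℝ} (hp0 : 0 ≤ p) (hp1 : p < 1) :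
    (2 / 3) * B1 n p + (1 / 3) * B2 n p ≤ 0.928 * ((1 - p) ^ n * Real.exp (Lp n p)) := by
  have hq : 0 < 1 - p := by linarith
  have hL : 0 ≤ Lp n p := by unfold Lp; positivity
  unfold B1 B2
  simp only [term1, term2]
  set L := Lp n p
  have key : (2 / 3) * ∑ j ∈ range n, (L ^ (2 * j + 1) / (2 * j + 1).factorial * GG (0.3354 * 0.6687) j +
      L ^ (2 * (j + 1)) / (2 * (j + 1)).factorial * (2 * 0.3354 * GG (0.3354 * 0.6687) j)) +
      (1 / 3) * ∑ j ∈ range n, L ^ (2 * j + 1) / (2 * j + 1).factorial * GG (0.3354 * 0.3354) j ≤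
      0.928 * Real.exp L := by
    calc _ = ∑ j ∈ range n, (L ^ (2 * j + 1) / (2 * j + 1).factorial *
          ((2 / 3) * GG (0.3354 * 0.6687) j + (1 / 3) * GG (0.3354 * 0.3354) j) +
          L ^ (2 * (j + 1)) / (2 * (j + 1)).factorial * ((2 / 3) * (2 * 0.3354) * GG (0.3354 * 0.6687) j)) := by
          rw [Finset.mul_sum, Finset.mul_sum, ← Finset.sum_add_distrib]
          exact Finset.sum_congr rfl fun j _ => by ring
      _ ≤ ∑ j ∈ range n, (L ^ (2 * j + 1) / (2 * j + 1).factorial * 1.14 +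
          L ^ (2 * (j + 1)) / (2 * (j + 1)).factorial * 0.7156) := by
          refine Finset.sum_le_sum fun j _ => ?_
          have := coef j
          gcongr
          · exact this.1
          · linarith [this.2]
      _ ≤ Real.sinh L * 1.14 + (Real.cosh L - 1) * 0.7156 := by
          rw [Finset.sum_add_distrib, ← Finset.sum_mul, ← Finset.sum_mul]
          gcongr
          · exact sum_sinh hL n
          · exact sum_cosh hL n
      _ ≤ _ := by
          rw [Real.sinh_eq, Real.cosh_eq]
          have := Real.exp_pos (-L)
          have := Real.exp_pos L
          linarith
  have hqn : 0 ≤ (1 - p) ^ n := by positivity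
  calc _ = (1 - p) ^ n * ((2 / 3) * ∑ j ∈ range n, (L ^ (2 * j + 1) / (2 * j + 1).factorial * GG (0.3354 * 0.6687) j +
      L ^ (2 * (j + 1)) / (2 * (j + 1)).factorial * (2 * 0.3354 * GG (0.3354 * 0.6687) j)) +
      (1 / 3) * ∑ j ∈ range n, L ^ (2 * j + 1) / (2 * j + 1).factorial * GG (0.3354 * 0.3354) j) := by ring
    _ ≤ (1 - p) ^ n * (0.928 * Real.exp L) := mul_le_mul_of_nonneg_left key hqn
    _ = _ := by ring

lemma B1_nonneg {n : ℕ} {p : ℝ} (hp0 : 0 ≤ p) (hp1 : p < 1) : 0 ≤ B1 n p := by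
  have hq : 0 < 1 - p := by linarith
  have hL : 0 ≤ Lp n p := by unfold Lp; positivity
  unfold B1; positivity

lemma B2_nonneg {n : ℕ} {p : ℝ} (hp0 : 0 ≤ p) (hp1 : p < 1) : 0 ≤ B2 n p := by
  have hq : 0 < 1 - p := by linarith
  have hL : 0 ≤ Lp n p := by unfold Lp; positivity
  unfold B2; positivity

lemma B_bound {n : ℕ} {p C : ℝ} (hC0 : 0 ≤ C) (hn0 : 0 < n) (hp0 : 0 ≤ p) (hp : p ≤ C / n)
    (hn : 2 * C ≤ n) (hn2 : 200 * C ^ 2 ≤ n) :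
    (2 / 3) * B1 n p + (1 / 3) * B2 n p ≤ 0.94 := by
  have hn' : (0:ℝ) < n := by exact_mod_cast hn0
  have hp2 : p ≤ 1 / 2 := hp.trans (by rw [div_le_div_iff₀ hn' (by norm_num)]; linarith)
  refine (B_bound0 hp0 (by linarith)).trans ?_
  have h1 : (1 - p) ^ n ≤ Real.exp (-(n * p)) := by
    have := pow_le_pow_left₀ (by linarith) (Real.one_sub_le_exp_neg p) n
    rwa [← Real.exp_nat_mul, mul_neg] at this
  have h2 : (1 - p) ^ n * Real.exp (Lp n p) ≤ Real.exp 0.01 := by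
    refine (mul_le_mul_of_nonneg_right h1 (Real.exp_pos _).le).trans ?_
    rw [← Real.exp_add]
    apply Real.exp_le_exp.2
    unfold Lp
    have hq : 0 < 1 - p := by linarith
    have : -(n * p) + n * p / (1 - p) = n * p * p / (1 - p) := by field_simp; ring
    rw [this, div_le_iff₀ hq]
    have hnp : n * p ≤ C := by rw [le_div_iff₀ hn'] at hp; linarith
    have hnp0 : 0 ≤ n * p := by positivity
    have : n * (n * p * p) ≤ C ^ 2 := by nlinarith
    have : n * (n * p * p) ≤ n * 0.005 := by linarith
    have := le_of_mul_le_mul_left this hn'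
    linarith
  have h3 : Real.exp 0.01 ≤ 1 / 0.99 := by
    have h := Real.one_sub_le_exp_neg 0.01
    rw [Real.exp_neg] at h
    have hpos := Real.exp_pos 0.01
    rw [le_div_iff₀ (by norm_num)]
    rw [inv_eq_one_div, le_div_iff₀ hpos] at h
    norm_num at h ⊢
    linarith
  norm_num at h3 ⊢
  linarith

end WLA

namespace WLA
open Finset

/-- Standing hypotheses for one value of `n`. -/
structure Hyp (n : ℕ) (p C : ℝ) : Prop where
  hn : 0 < n
  hp0 : 0 ≤ p
  hp1 : p < 1
  hC0 : 0 ≤ C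
  hnp : (n : ℝ) * p ≤ C
  hB : (2 / 3) * B1 n p + (1 / 3) * B2 n p ≤ 0.94

lemma Hyp.hB1 {n : ℕ} {p C : ℝ} (H : Hyp n p C) : (2 / 3) * B1 n p ≤ 0.94 := by
  have := H.hB
  have := B2_nonneg (n := n) H.hp0 H.hp1
  linarith

lemma Hyp.om0 {n : ℕ} {p C : ℝ} (H : Hyp n p C) : ∀ d, 0 ≤ om n p d := om_nonneg H.hp0 H.hp1.le

lemma cnt_erase {n : ℕ} (a b : Fin 3) (R : Fin n → Bool) (c : Fin n → Fin 3) {w : Fin n}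
    (hw : w ∈ Sr R) : cnt (a, R) c b = #{u ∈ (Sr R).erase w | c u = b} + if c w = b then 1 else 0 := by
  unfold cnt Sd
  conv_lhs => rw [← Finset.insert_erase hw]
  rw [Finset.filter_insert]
  split_ifs with h
  · rw [Finset.card_insert_of_notMem (by simp)]
  · simp

lemma card_erase_split {n : ℕ} (b : Fin 3) (R : Fin n → Bool) (c : Fin n → Fin 3) {w : Fin n}
    (hw : w ∈ Sr R) : (Sr R).card = #{u ∈ (Sr R).erase w | c u = b} +
      #{u ∈ (Sr R).erase w | c u ≠ b} + 1 := by
  have : #{u ∈ (Sr R).erase w | c u = b} + #{u ∈ (Sr R).erase w | c u ≠ b} = _ :=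
    Finset.card_filter_add_card_filter_not (s := (Sr R).erase w) (fun u => c u = b)
  rw [Finset.card_erase_of_mem hw] at this
  have h2 : 0 < (Sr R).card := Finset.card_pos.2 ⟨w, hw⟩
  omega

lemma rule_change {n : ℕ} (a : Fin 3) (R : Fin n → Bool) {c c' : Fin n → Fin 3} {w : Fin n}
    (hcc : ∀ u, u ≠ w → c u = c' u) (h : rule (a, R) c ≠ rule (a, R) c') :
    (a = c w ∨ a = c' w) ∧ Piv c a w R := by
  have hw : w ∈ Sr R := by
    by_contra hw
    exact h (rule_congr _ fun u hu => hcc u (by rintro rfl; exact hw hu))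
  have e1 := cnt_erase a a R c hw
  have e2 := cnt_erase a a R c' hw
  have e3 := card_erase_split a R c hw
  have e4 : #{u ∈ (Sr R).erase w | c' u = a} = #{u ∈ (Sr R).erase w | c u = a} := by
    congr 1
    refine Finset.filter_congr fun u hu => ?_
    rw [hcc u (Finset.ne_of_mem_erase hu)]
  rw [e4] at e2
  unfold rule at h
  simp only [e1, e2, Sd] at h
  unfold Piv
  refine ⟨?_, hw, ?_⟩
  · by_contra hcon
    push Not at hcon
    simp [hcon.1.symm, hcon.2.symm] at h
  · split_ifs at h <;> first | (exact absurd rfl h) | omega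

lemma sum_two_colours (b b' : Fin 3) {K : ℝ} (hK : 0 ≤ K) :
    ∑ a : Fin 3, ind (a = b ∨ a = b') * K ≤ 2 * K := by
  rw [← Finset.sum_mul]
  refine mul_le_mul_of_nonneg_right ?_ hK
  refine (Finset.sum_le_sum fun a _ => ind_or_le _ _).trans ?_
  rw [Finset.sum_add_distrib]
  have : ∀ b : Fin 3, ∑ a : Fin 3, ind (a = b) = 1 := by
    intro b
    rw [← sum_ind_eq b]
    exact Finset.sum_congr rfl fun a _ => ind_congr eq_comm
  rw [this, this]; norm_num

lemma rule_change_bal {n : ℕ} {p C : ℝ} (H : Hyp n p C) {c c' : Fin n → Fin 3} {w : Fin n}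
    (hcc : ∀ u, u ≠ w → c u = c' u) (hc : Bal c) :
    n * ∑ d, om n p d * ind (rule d c ≠ rule d c') ≤ 0.94 := by
  have hB1 := B1_nonneg (n := n) H.hp0 H.hp1
  rw [om_sum_eq]
  calc _ ≤ (n:ℝ) * ((1 / 3) * ∑ a : Fin 3, ind (a = c w ∨ a = c' w) *
        Ex (bw p) (fun R => ind (Piv c a w R))) := by
        gcongr with a _
        rw [← Ex_mul_left]
        refine Ex_mono (bw_nonneg H.hp0 H.hp1.le) fun R => ?_
        rw [← ind_and]
        exact ind_mono fun h => rule_change a R hcc h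
    _ = (1 / 3) * ∑ a : Fin 3, ind (a = c w ∨ a = c' w) *
        (n * Ex (bw p) (fun R => ind (Piv c a w R))) := by
        rw [mul_left_comm, Finset.mul_sum]
        congr 1
        exact Finset.sum_congr rfl fun a _ => by ring
    _ ≤ (1 / 3) * ∑ a : Fin 3, ind (a = c w ∨ a = c' w) * B1 n p := by
        gcongr with a _
        · exact ind_nonneg _
        · exact piv_le H.hp0 H.hp1 hc a w
    _ ≤ (1 / 3) * (2 * B1 n p) := by
        gcongr
        exact sum_two_colours _ _ hB1
    _ ≤ 0.94 := by linarith [H.hB1]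

def hyb {n : ℕ} (c c' : Fin n → Fin 3) (k : ℕ) : Fin n → Fin 3 :=
  fun u => if u.val < k then c' u else c u

lemma hyb_chain {n : ℕ} (d : DD n) (c c' : Fin n → Fin 3) (h : rule d c ≠ rule d c') :
    ∃ w : Fin n, rule d (hyb c c' w) ≠ rule d (hyb c c' (w + 1)) := by
  by_contra hcon
  push Not at hcon
  apply h
  have : ∀ k, k ≤ n → rule d (hyb c c' k) = rule d c := by
    intro k
    induction k with
    | zero => intro _; congr 1
    | succ k ih =>
      intro hk
      rw [← hcon ⟨k, hk⟩]
      exact ih (by omega)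
  rw [← this n le_rfl]
  congr 1
  funext u
  simp [hyb]

lemma hyb_agree {n : ℕ} (c c' : Fin n → Fin 3) (w : Fin n) :
    ∀ u, u ≠ w → hyb c c' w u = hyb c c' (w + 1) u := by
  intro u hu
  have : u.val ≠ w.val := fun h => hu (Fin.ext h)
  unfold hyb
  by_cases h : u.val < w.val
  · rw [if_pos h, if_pos (by omega)]
  · rw [if_neg h, if_neg (by omega)]

lemma hyb_same {n : ℕ} (c c' : Fin n → Fin 3) (w : Fin n) (h : c w = c' w) :
    hyb c c' w = hyb c c' (w + 1) := by
  funext u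
  by_cases hu : u = w
  · subst hu; simp [hyb, h]
  · exact hyb_agree c c' w u hu

/-- One-step contraction. -/
lemma contraction {n : ℕ} {p C : ℝ} (H : Hyp n p C) (c c' : Fin n → Fin 3) :
    n * ∑ d, om n p d * ind (rule d c ≠ rule d c') ≤
      0.94 * ∑ w, ind (c w ≠ c' w) + C * ∑ w : Fin n, ind (¬ Bal (hyb c c' w)) := by
  have pt : ∀ d, ind (rule d c ≠ rule d c') ≤
      ∑ w : Fin n, ind (rule d (hyb c c' w) ≠ rule d (hyb c c' (w + 1))) := by
    intro d
    refine le_trans (ind_mono fun h => ?_) (ind_exists_le _ _)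
    obtain ⟨w, hw⟩ := hyb_chain d c c' h
    exact ⟨w, mem_univ _, hw⟩
  have one : ∀ w : Fin n, n * ∑ d, om n p d * ind (rule d (hyb c c' w) ≠ rule d (hyb c c' (w + 1)))
      ≤ 0.94 * ind (c w ≠ c' w) + C * ind (¬ Bal (hyb c c' w)) := by
    intro w
    by_cases h : c w = c' w
    · rw [hyb_same c c' w h]
      have e : ∀ d : DD n, ind (rule d (hyb c c' (w + 1)) ≠ rule d (hyb c c' (w + 1))) = 0 :=
        fun d => ind_false (by simp)
      simp only [e, mul_zero, Finset.sum_const_zero]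
      exact add_nonneg (mul_nonneg (by norm_num) (ind_nonneg _)) (mul_nonneg H.hC0 (ind_nonneg _))
    · rw [ind_true h]
      by_cases hb : Bal (hyb c c' w)
      · have := rule_change_bal H (hyb_agree c c' w) hb
        rw [ind_false (not_not.2 hb)]; linarith
      · rw [ind_true hb]
        have : ∑ d, om n p d * ind (rule d (hyb c c' w) ≠ rule d (hyb c c' (w + 1))) ≤
            ∑ d, om n p d * ind (w ∈ Sd d) := by
          refine Finset.sum_le_sum fun d _ => mul_le_mul_of_nonneg_left (ind_mono fun h => ?_) (H.om0 d)
          by_contra hw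
          exact h (rule_congr _ fun u hu => hyb_agree c c' w u (by rintro rfl; exact hw hu))
        rw [om_mem] at this
        have h3 := mul_le_mul_of_nonneg_left this (Nat.cast_nonneg (α := ℝ) n)
        linarith [H.hnp]
  calc _ ≤ (n:ℝ) * ∑ d, om n p d * ∑ w : Fin n,
        ind (rule d (hyb c c' w) ≠ rule d (hyb c c' (w + 1))) := by
        gcongr with d _
        · exact H.om0 d
        · exact pt d
    _ = ∑ w : Fin n, n * ∑ d, om n p d *
        ind (rule d (hyb c c' w) ≠ rule d (hyb c c' (w + 1))) := by
        simp only [Finset.mul_sum]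
        rw [Finset.sum_comm]
    _ ≤ ∑ w : Fin n, (0.94 * ind (c w ≠ c' w) + C * ind (¬ Bal (hyb c c' w))) :=
        Finset.sum_le_sum fun w _ => one w
    _ = _ := by rw [Finset.sum_add_distrib, Finset.mul_sum, Finset.mul_sum]

/-- Collision count. -/
lemma collision {n : ℕ} {p C : ℝ} (H : Hyp n p C) (r : ℕ) :
    ∑ v : Fin n, Ex (om n p) (fun x => ∑ d, om n p d *
      ∑ w, ind (w ∈ Sd d) * ind (v ∈ ball Sd x r w)) ≤ C * KK C r := by
  have e : ∀ v : Fin n, Ex (om n p) (fun x => ∑ d, om n p d *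
      ∑ w, ind (w ∈ Sd d) * ind (v ∈ ball Sd x r w)) =
      p * ∑ w, Ex (om n p) (fun x => ind (v ∈ ball Sd x r w)) := by
    intro v
    rw [Finset.mul_sum]
    simp only [← Ex_mul_left]
    rw [← Ex_sum]
    congr 1; funext x
    simp only [Finset.mul_sum]
    rw [Finset.sum_comm]
    refine Finset.sum_congr rfl fun w _ => ?_
    refine Eq.trans ?_ (congrArg (· * ind (v ∈ ball Sd x r w)) (om_mem p w))
    beta_reduce
    rw [Finset.sum_mul]
    exact Finset.sum_congr rfl fun d _ => by ring
  simp only [e]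
  have hK := KK_pos H.hC0 r
  calc _ ≤ ∑ v : Fin n, p * KK C r := by
        gcongr with v _
        · exact H.hp0
        · exact inball_le H.om0 (om_sum n p) (Sd_e0 n) H.hp0 (fun w => (om_mem p w).le)
            (by simpa using H.hnp) H.hC0 v r
    _ = (n * p) * KK C r := by simp; ring
    _ ≤ _ := mul_le_mul_of_nonneg_right H.hnp (by linarith)

lemma col_update {n : ℕ} (x : Fin n → DD n) (v w : Fin n) (d : DD n) (t : ℕ)
    (h : v ∉ ball Sd x t w) : col (Function.update x v d) t w = col x t w :=
  col_local t w x _ fun u hu => Function.update_of_ne (by rintro rfl; exact h hu) _ _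

noncomputable def AA (C : ℝ) : ℕ → ℝ
  | 0 => 0
  | t + 1 => 0.94 * AA C t + (C * (3000000 * KK C (t + 1) ^ 2) + C * KK C (t + 1))

/-- Expected number of vertices changing at step `t`. -/
lemma phase1 {n : ℕ} {p C : ℝ} (H : Hyp n p C) (t : ℕ) :
    Ex (om n p) (fun x => ∑ v, ind (col x t v ≠ col x (t + 1) v)) ≤ 0.94 ^ t * n + AA C t := by
  have hn' : (0:ℝ) < n := by exact_mod_cast H.hn
  induction t with
  | zero =>
    refine (Ex_mono H.om0 (G := fun _ => (n:ℝ)) fun x => ?_).trans ?_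
    · refine (Finset.sum_le_sum fun v _ => ind_le_one _).trans ?_
      simp
    · rw [Ex_const (om_sum n p)]; simp [AA]
  | succ t ih =>
    have step : ∀ v : Fin n, Ex (om n p) (fun x => ind (col x (t+1) v ≠ col x (t + 1 + 1) v)) ≤
        Ex (om n p) (fun x => ∑ d, om n p d * ind (rule d (col x t) ≠ rule d (col x (t+1)))) +
        Ex (om n p) (fun x => ∑ d, om n p d *
          ∑ w, ind (w ∈ Sd d) * ind (v ∈ ball Sd x (t+1) w)) := by
      intro v
      rw [Ex_resample (om_sum n p) v, ← Ex_add]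
      refine Ex_mono H.om0 fun x => ?_
      rw [← Finset.sum_add_distrib]
      refine Finset.sum_le_sum fun d _ => ?_
      rw [← mul_add]
      refine mul_le_mul_of_nonneg_left ?_ (H.om0 d)
      simp only [col, Function.update_self]
      simp only [← ind_and]
      refine le_trans (ind_mono fun h => ?_) ((ind_or_le _ _).trans
        (add_le_add_right (ind_exists_le univ (fun w => w ∈ Sd d ∧ v ∈ ball Sd x (t+1) w)) _))
      by_contra hcon
      push Not at hcon
      apply h
      rw [rule_congr d (c := col (Function.update x v d) t) (c' := col x t),
        rule_congr d (c := fun w => rule (Function.update x v d w) (col (Function.update x v d) t))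
          (c' := col x (t+1))]
      · exact hcon.1
      · intro w hw
        have := col_update x v w d (t+1) (hcon.2 w (mem_univ _) hw)
        exact this
      · intro w hw
        refine col_update x v w d t fun hv => hcon.2 w (mem_univ _) hw (ball_mono_succ _ _ _ hv)
    rw [Ex_sum]
    refine (Finset.sum_le_sum fun v _ => step v).trans ?_
    rw [Finset.sum_add_distrib, Finset.sum_const, Finset.card_univ, Fintype.card_fin, nsmul_eq_mul,
      ← Ex_mul_left]
    have c1 : Ex (om n p) (fun x => n * ∑ d, om n p d * ind (rule d (col x t) ≠ rule d (col x (t+1))))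
        ≤ 0.94 * (0.94 ^ t * n + AA C t) + C * (3000000 * KK C (t + 1) ^ 2) := by
      refine (Ex_mono H.om0 fun x => contraction H (col x t) (col x (t+1))).trans ?_
      rw [Ex_add, Ex_mul_left, Ex_mul_left]
      have hbal : Ex (om n p) (fun x => ∑ w : Fin n, ind (¬ Bal (hyb (col x t) (col x (t+1)) w))) ≤
          3000000 * KK C (t + 1) ^ 2 := by
        rw [Ex_sum]
        have : ∀ w : Fin n, Ex (om n p) (fun x => ind (¬ Bal (hyb (col x t) (col x (t+1)) w))) ≤
            3000000 * KK C (t + 1) ^ 2 / n := by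
          intro w
          refine Ex_not_bal (g := fun u x => hyb (col x t) (col x (t+1)) w u) H.hn H.hp0 H.hp1.le H.hnp H.hC0 (r := t+1) ?_ ?_
          · intro u x y h
            unfold hyb
            by_cases hu : u.val < w.val
            · simp only [hu, if_true]; exact col_local (t+1) u x y h
            · simp only [hu, if_false]; exact (col_local t u).mono x y h
          · intro u a
            unfold hyb
            by_cases hu : u.val < w.val
            · simp only [hu, if_true]; exact Ex_col p (t+1) u a
            · simp only [hu, if_false]; exact Ex_col p t u a
        refine (Finset.sum_le_sum fun w _ => this w).trans (le_of_eq ?_)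
        simp; field_simp
      have := mul_le_mul_of_nonneg_left hbal H.hC0
      have := mul_le_mul_of_nonneg_left ih (by norm_num : (0:ℝ) ≤ 0.94)
      linarith
    have c2 := collision H (t+1)
    simp only [AA]
    rw [pow_succ]
    linarith

end WLA

namespace WLA
open Finset

/-- `w` is a sensitive out-neighbour for data `d`. -/
def sens {n : ℕ} (d : DD n) (c : Fin n → Fin 3) (w : Fin n) : Prop :=
  c w ≠ rule d c ∧ cnt d c (rule d c) = (Sd d).card / 2

lemma sens_congr {n : ℕ} (d : DD n) {c c' : Fin n → Fin 3} (h : ∀ w ∈ Sd d, c w = c' w)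
    {w : Fin n} (hw : w ∈ Sd d) : sens d c w ↔ sens d c' w := by
  unfold sens
  rw [rule_congr d h, cnt_congr d h, h w hw]

lemma sens_cases {n : ℕ} (a : Fin 3) (R : Fin n → Bool) (c : Fin n → Fin 3) {w : Fin n}
    (hw : w ∈ Sr R) (h : sens (a, R) c w) :
    (a ≠ c w ∧ Piv c a w R) ∨ (a = c w ∧ Piv2 c a w R) := by
  obtain ⟨h1, h2⟩ := h
  have e1 := cnt_erase a a R c hw
  have e1' := cnt_erase a (a + 1) R c hw
  have e3 := card_erase_split a R c hw
  have e5 := cnt_add_le (a, R) c (fin3_succ_ne a)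
  unfold rule at h1 h2
  have hS : Sd ((a, R) : DD n) = Sr R := rfl
  simp only [hS] at h1 h2 e5
  split_ifs at h1 h2 with h3
  · right
    have hN : (Sr R).card = cnt (a, R) c a + cnt (a, R) c (a + 1) := by omega
    have hall : ∀ u ∈ Sr R, c u = a ∨ c u = a + 1 := by
      intro u hu
      by_contra hcon
      push Not at hcon
      have hlt : #({u ∈ Sr R | c u = a} ∪ {u ∈ Sr R | c u = a + 1}) < #(Sr R) := by
        apply Finset.card_lt_card
        rw [Finset.ssubset_iff_of_subset
          (Finset.union_subset (Finset.filter_subset _ _) (Finset.filter_subset _ _))]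
        exact ⟨u, hu, by simp [hcon.1, hcon.2]⟩
      rw [Finset.card_union_of_disjoint] at hlt
      · unfold cnt Sd at hN
        simp only at hN
        omega
      · rw [Finset.disjoint_filter]
        intro u _ h1 h2
        exact fin3_succ_ne a (h2.symm.trans h1)
    have hwa : c w = a := (hall w hw).resolve_right h1
    refine ⟨hwa.symm, hw, fun u hu => hall u (Finset.mem_of_mem_erase hu), ?_⟩
    rw [if_pos hwa] at e1
    rw [if_neg h1] at e1'
    omega
  · left
    rw [if_neg h1] at e1
    refine ⟨fun h => h1 h.symm, hw, ?_, ?_⟩ <;> omega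

lemma sens_bal {n : ℕ} {p C : ℝ} (H : Hyp n p C) {c : Fin n → Fin 3} (hc : Bal c) (w : Fin n) :
    n * ∑ d, om n p d * ind (w ∈ Sd d ∧ sens d c w) ≤ 0.94 := by
  have hB1 := B1_nonneg (n := n) H.hp0 H.hp1
  rw [om_sum_eq]
  calc _ ≤ (n:ℝ) * ((1 / 3) * ∑ a : Fin 3, (ind (a ≠ c w) * Ex (bw p) (fun R => ind (Piv c a w R)) +
        ind (a = c w) * Ex (bw p) (fun R => ind (Piv2 c a w R)))) := by
        gcongr with a _
        rw [← Ex_mul_left, ← Ex_mul_left, ← Ex_add]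
        refine Ex_mono (bw_nonneg H.hp0 H.hp1.le) fun R => ?_
        rw [← ind_and, ← ind_and]
        refine le_trans (ind_mono fun h => ?_) (ind_or_le _ _)
        exact sens_cases a R c h.1 h.2
    _ = (1 / 3) * ∑ a : Fin 3, (ind (a ≠ c w) * (n * Ex (bw p) (fun R => ind (Piv c a w R))) +
        ind (a = c w) * (n * Ex (bw p) (fun R => ind (Piv2 c a w R)))) := by
        rw [mul_left_comm, Finset.mul_sum]
        congr 1
        exact Finset.sum_congr rfl fun a _ => by ring
    _ ≤ (1 / 3) * ∑ a : Fin 3, (ind (a ≠ c w) * B1 n p + ind (a = c w) * B2 n p) := by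
        gcongr with a _
        · exact ind_nonneg _
        · exact piv_le H.hp0 H.hp1 hc a w
        · exact ind_nonneg _
        · exact piv2_le H.hp0 H.hp1 hc a w
    _ = (2 / 3) * B1 n p + (1 / 3) * B2 n p := by
        have e : ∑ a : Fin 3, ind (a = c w) = 1 := by
          rw [← sum_ind_eq (c w)]
          exact Finset.sum_congr rfl fun a _ => ind_congr eq_comm
        simp only [ne_eq, ind_not]
        rw [Finset.sum_add_distrib, ← Finset.sum_mul, ← Finset.sum_mul, Finset.sum_sub_distrib, e]
        simp
        ring
    _ ≤ 0.94 := H.hB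

/-- Colour history. -/
def hist {n : ℕ} (T : ℕ) (x : Fin n → DD n) (v : Fin n) : Fin (T + 1) → Fin 3 :=
  fun i => col x i v

lemma ball_mono_le {n : ℕ} (x : Fin n → DD n) {i r : ℕ} (h : i ≤ r) (u : Fin n) :
    ball Sd x i u ⊆ ball Sd x r u := by
  induction r, h using Nat.le_induction with
  | base => exact fun _ h => h
  | succ r _ ih => exact ih.trans (ball_mono_succ _ _ _)

lemma hist_local {n : ℕ} (T : ℕ) (u : Fin n) : LocalAt Sd T u (fun x => hist T x u) := by
  intro x y h
  funext i
  exact col_local i u x y fun v hv => h v (ball_mono_le x (by omega) u hv)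

/-- Sensitive contribution of row `d` to the class `h`. -/
noncomputable def contr {n : ℕ} (M T : ℕ) (h : Fin (T + 1) → Fin 3) (d : DD n) (x : Fin n → DD n) : ℝ :=
  ∑ w, ind ((Sd d).card ≤ M ∧ w ∈ Sd d ∧ sens d (col x T) w) * ind (hist T x w = h)

lemma contr_nonneg {n : ℕ} (M T : ℕ) (h : Fin (T + 1) → Fin 3) (d : DD n) (x : Fin n → DD n) :
    0 ≤ contr M T h d x :=
  Finset.sum_nonneg fun _ _ => mul_nonneg (ind_nonneg _) (ind_nonneg _)

lemma contr_le {n : ℕ} (M T : ℕ) (h : Fin (T + 1) → Fin 3) (d : DD n) (x : Fin n → DD n) :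
    contr M T h d x ≤ M := by
  unfold contr
  by_cases hM : (Sd d).card ≤ M
  · calc _ ≤ ∑ w, ind (w ∈ Sd d) := by
          refine Finset.sum_le_sum fun w _ => ?_
          calc _ ≤ ind (w ∈ Sd d) * 1 := by
                refine mul_le_mul (ind_mono fun h => h.2.1) (ind_le_one _) (ind_nonneg _) (ind_nonneg _)
            _ = _ := mul_one _
      _ = (Sd d).card := by
          rw [← card_filter_eq_sum_ind]; congr 2; ext; simp
      _ ≤ M := by exact_mod_cast hM
  · have : ∀ w, ind ((Sd d).card ≤ M ∧ w ∈ Sd d ∧ sens d (col x T) w) = 0 :=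
      fun w => ind_false fun h => hM h.1
    simp [this]

lemma contr_congr {n : ℕ} (M T : ℕ) (h : Fin (T + 1) → Fin 3) (d : DD n) (x y : Fin n → DD n)
    (hxy : ∀ w ∈ Sd d, hist T y w = hist T x w) : contr M T h d y = contr M T h d x := by
  unfold contr
  refine Finset.sum_congr rfl fun w _ => ?_
  by_cases hw : w ∈ Sd d
  · rw [hxy w hw]
    congr 1
    have hc : ∀ w ∈ Sd d, col y T w = col x T w := fun w hw => by
      have := congrFun (hxy w hw) (Fin.last T)
      simpa [hist] using this
    exact ind_congr (by rw [sens_congr d hc hw])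
  · rw [ind_false (P := (Sd d).card ≤ M ∧ w ∈ Sd d ∧ sens d (col y T) w) (fun h => hw h.2.1),
      ind_false (P := (Sd d).card ≤ M ∧ w ∈ Sd d ∧ sens d (col x T) w) (fun h => hw h.2.1),
      zero_mul, zero_mul]

noncomputable def A2 (C : ℝ) (M T : ℕ) : ℝ := C * (3000000 * KK C T ^ 2) + M * (C * KK C T)

lemma contr_mean {n : ℕ} {p C : ℝ} (H : Hyp n p C) (M T : ℕ) (h : Fin (T + 1) → Fin 3) :
    ∑ v, Ex (om n p) (fun x => contr M T h (x v) x - 0.94 * ind (hist T x v = h)) ≤ A2 C M T := by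
  have hn' : (0:ℝ) < n := by exact_mod_cast H.hn
  have step : ∀ v : Fin n, Ex (om n p) (fun x => contr M T h (x v) x) ≤
      Ex (om n p) (fun x => ∑ d, om n p d * contr M T h d x) +
      M * Ex (om n p) (fun x => ∑ d, om n p d *
          ∑ w, ind (w ∈ Sd d) * ind (v ∈ ball Sd x T w)) := by
    intro v
    rw [Ex_resample (om_sum n p) v, ← Ex_mul_left, ← Ex_add]
    refine Ex_mono H.om0 fun x => ?_
    rw [Finset.mul_sum, ← Finset.sum_add_distrib]
    refine Finset.sum_le_sum fun d _ => ?_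
    rw [mul_left_comm, ← mul_add]
    refine mul_le_mul_of_nonneg_left ?_ (H.om0 d)
    rw [Function.update_self]
    simp only [← ind_and]
    have hs : 0 ≤ ∑ w, ind (w ∈ Sd d ∧ v ∈ ball Sd x T w) :=
      Finset.sum_nonneg fun w _ => ind_nonneg _
    by_cases hc : ∃ w ∈ Sd d, v ∈ ball Sd x T w
    · obtain ⟨w, hw, hv⟩ := hc
      have h1 : 1 ≤ ∑ w, ind (w ∈ Sd d ∧ v ∈ ball Sd x T w) := by
        rw [← ind_true (⟨hw, hv⟩ : w ∈ Sd d ∧ v ∈ ball Sd x T w)]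
        exact Finset.single_le_sum (f := fun w => ind (w ∈ Sd d ∧ v ∈ ball Sd x T w))
          (fun w _ => ind_nonneg _) (mem_univ w)
      have h2 := contr_le M T h d (Function.update x v d)
      have h3 := contr_nonneg M T h d x
      have h4 := mul_le_mul_of_nonneg_left h1 (Nat.cast_nonneg (α := ℝ) M)
      linarith
    · push Not at hc
      rw [contr_congr M T h d x]
      · have := mul_nonneg (Nat.cast_nonneg (α := ℝ) M) hs
        linarith
      · intro w hw
        exact hist_local T w x _ fun u hu =>
          Function.update_of_ne (by rintro rfl; exact hc w hw hu) _ _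
  have main : Ex (om n p) (fun x => n * ∑ d, om n p d * contr M T h d x) ≤
      0.94 * ∑ w, Ex (om n p) (fun x => ind (hist T x w = h)) + C * (3000000 * KK C T ^ 2) := by
    have pt : ∀ x : Fin n → DD n, n * ∑ d, om n p d * contr M T h d x ≤
        0.94 * ∑ w, ind (hist T x w = h) + C * (n * ind (¬ Bal (col x T))) := by
      intro x
      have e : n * ∑ d, om n p d * contr M T h d x ≤ ∑ w, (n * ∑ d, om n p d *
          ind (w ∈ Sd d ∧ sens d (col x T) w)) * ind (hist T x w = h) := by
        unfold contr
        calc _ = ∑ w, (n * ∑ d, om n p d *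
          ind ((Sd d).card ≤ M ∧ w ∈ Sd d ∧ sens d (col x T) w)) * ind (hist T x w = h) := by
              simp only [Finset.mul_sum, Finset.sum_mul]
              rw [Finset.sum_comm]
              exact Finset.sum_congr rfl fun w _ => Finset.sum_congr rfl fun d _ => by ring
          _ ≤ _ := by
              gcongr with w _ d _
              · exact ind_nonneg _
              · exact H.om0 d
              · exact ind_mono fun h => h.2
      refine e.trans ?_
      by_cases hb : Bal (col x T)
      · rw [ind_false (not_not.2 hb), Finset.mul_sum]
        simp only [mul_zero, add_zero]
        refine Finset.sum_le_sum fun w _ => ?_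
        exact mul_le_mul_of_nonneg_right (sens_bal H hb w) (ind_nonneg _)
      · rw [ind_true hb, mul_one]
        have : ∀ w : Fin n, (n * ∑ d, om n p d * ind (w ∈ Sd d ∧ sens d (col x T) w)) *
            ind (hist T x w = h) ≤ C := by
          intro w
          have h1 : ∑ d, om n p d * ind (w ∈ Sd d ∧ sens d (col x T) w) ≤ p := by
            refine le_trans (Finset.sum_le_sum fun d _ => ?_) (om_mem p w).le
            exact mul_le_mul_of_nonneg_left (ind_mono fun h => h.1) (H.om0 d)
          have h2 := (mul_le_mul_of_nonneg_left h1 hn'.le).trans H.hnp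
          have h3 := ind_le_one (hist T x w = h)
          have h4 := ind_nonneg (hist T x w = h)
          have := H.hC0
          calc _ ≤ C * ind (hist T x w = h) := mul_le_mul_of_nonneg_right h2 h4
            _ ≤ C := by nlinarith
        refine (Finset.sum_le_sum fun w _ => this w).trans ?_
        simp
        have : 0 ≤ ∑ w, ind (hist T x w = h) := Finset.sum_nonneg fun w _ => ind_nonneg _
        have : 0 ≤ 0.94 * ∑ w, ind (hist T x w = h) := by positivity
        linarith
    refine (Ex_mono H.om0 pt).trans ?_
    rw [Ex_add, Ex_mul_left, Ex_mul_left, Ex_mul_left, Ex_sum]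
    have := Ex_not_bal (g := fun u x => col x T u) H.hn H.hp0 H.hp1.le H.hnp H.hC0 (r := T)
      (fun u => col_local T u) (fun u a => Ex_col p T u a)
    have t2 : n * Ex (om n p) (fun x => ind (¬ Bal (col x T))) ≤ 3000000 * KK C T ^ 2 := by
      refine (mul_le_mul_of_nonneg_left this hn'.le).trans (le_of_eq ?_)
      field_simp
    have := mul_le_mul_of_nonneg_left t2 H.hC0
    linarith
  simp only [Ex_sub, Ex_mul_left]
  rw [Finset.sum_sub_distrib, ← Finset.mul_sum]
  have s1 := Finset.sum_le_sum fun v (_ : v ∈ univ) => step v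
  rw [Finset.sum_add_distrib, Finset.sum_const, Finset.card_univ, Fintype.card_fin, nsmul_eq_mul,
      ← Ex_mul_left, ← Finset.mul_sum] at s1
  have s2 := mul_le_mul_of_nonneg_left (collision H T) (Nat.cast_nonneg (α := ℝ) M)
  unfold A2
  linarith

lemma contr_local {n : ℕ} (M T : ℕ) (h : Fin (T + 1) → Fin 3) (v : Fin n) :
    LocalAt Sd (T + 1) v
      (fun x => contr M T h (x v) x - 0.94 * ind (hist T x v = h)) := by
  intro x y hxy
  have e1 := (hist_local T v).mono x y hxy
  have e2 : y v = x v := hxy v (self_mem_ball _ _ _)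
  simp only [e1, e2]
  congr 1
  exact contr_congr M T h (x v) x y fun w hw =>
    hist_local T w x y fun u hu => hxy u (ball_succ_of_mem hw hu)

/-- Statistic (S2). -/
lemma S2 {n : ℕ} {p C : ℝ} (H : Hyp n p C) (M T : ℕ) (h : Fin (T + 1) → Fin 3) {t : ℝ} (ht : 0 < t) :
    Ex (om n p) (fun x => ind (0.94 * ∑ v, ind (hist T x v = h) + (A2 C M T + t) ≤
      ∑ v, contr M T h (x v) x)) ≤ 2 * (M + 1 : ℝ) ^ 2 * KK C (T + 1) ^ 2 * n / t ^ 2 := by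
  have := lln (f := fun v x => contr M T h (x v) x - 0.94 * ind (hist T x v = h)) H.om0 (om_sum n p)
    (Sd_e0 n) H.hp0 (fun w => (om_mem p w).le) (by simpa using H.hnp) H.hC0 (r := T + 1)
    (M := (M + 1 : ℝ)) (fun v => contr_local M T h v) (fun v x => by
      have h1 := contr_le M T h (x v) x
      have h2 := contr_nonneg M T h (x v) x
      have h3 := ind_le_one (hist T x v = h)
      have h4 := ind_nonneg (hist T x v = h)
      rw [abs_le]; constructor <;> linarith [Nat.cast_nonneg (α := ℝ) M]) ht
  rw [Fintype.card_fin] at this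
  refine (Ex_mono H.om0 fun x => ind_mono fun hx => ?_).trans this
  have := contr_mean H M T h
  simp only [Finset.sum_sub_distrib, ← Finset.mul_sum] at this ⊢
  linarith

end WLA

namespace WLA
open Finset

lemma Ex_prod {V D : Type*} [Fintype V] [DecidableEq V] [Fintype D] (ω : D → ℝ) (f : V → D → ℝ) :
    Ex ω (fun x => ∏ v, f v (x v)) = ∏ v, ∑ d, ω d * f v d := by
  have := Finset.prod_univ_sum (ι := V) (fun _ => (Finset.univ : Finset D)) (fun v d => ω d * f v d)
  rw [this, Fintype.piFinset_univ]
  unfold Ex wt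
  exact Finset.sum_congr rfl fun x _ => by rw [← Finset.prod_mul_distrib]

lemma Ex_arcs {n : ℕ} (p : ℝ) (F : Finset (Fin n × Fin n)) :
    Ex (om n p) (fun x => ind (∀ q ∈ F, q.2 ∈ Sd (x q.1))) = p ^ F.card := by
  have e1 : ∀ x : Fin n → DD n, ind (∀ q ∈ F, q.2 ∈ Sd (x q.1)) =
      ∏ v, ∏ w, (if (v, w) ∈ F then ind ((x v).2 w = true) else 1) := by
    intro x
    by_cases h : ∀ q ∈ F, q.2 ∈ Sd (x q.1)
    · rw [ind_true h]
      symm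
      refine Finset.prod_eq_one fun v _ => Finset.prod_eq_one fun w _ => ?_
      split_ifs with hF
      · exact ind_true (mem_Sd.1 (h _ hF))
      · rfl
    · rw [ind_false h]
      push Not at h
      obtain ⟨⟨v, w⟩, hF, h⟩ := h
      symm
      refine Finset.prod_eq_zero (mem_univ v) (Finset.prod_eq_zero (mem_univ w) ?_)
      rw [if_pos hF]
      exact ind_false fun h' => h (mem_Sd.2 h')
  simp only [e1]
  rw [Ex_prod (om n p) (fun v d => ∏ w, (if (v, w) ∈ F then ind (d.2 w = true) else 1))]
  have e2 : ∀ v : Fin n, ∑ d, om n p d * ∏ w, (if (v, w) ∈ F then ind (d.2 w = true) else 1) =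
      ∏ w, if (v, w) ∈ F then p else 1 := by
    intro v
    rw [om_sum_eq]
    simp only
    have : Ex (bw p) (fun R : Fin n → Bool => ∏ w, (if (v, w) ∈ F then ind (R w = true) else 1)) =
        ∏ w, if (v, w) ∈ F then p else 1 := by
      rw [Ex_prod (bw p) (fun w b => if (v, w) ∈ F then ind (b = true) else 1)]
      refine Finset.prod_congr rfl fun w _ => ?_
      split_ifs
      · simp [bw, ind]
      · simp only [mul_one]; exact bw_sum p
    rw [this]; simp
  simp only [e2]
  rw [← Finset.prod_product' (f := fun v w => if (v, w) ∈ F then p else 1)]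
  simp [Finset.prod_ite_mem]

/-- Number of arcs (loops included) spanned by `Y`. -/
def arcs {n : ℕ} (x : Fin n → DD n) (Y : Finset (Fin n)) : ℕ :=
  #{q ∈ Y ×ˢ Y | q.2 ∈ Sd (x q.1)}

lemma Ex_dense {n : ℕ} {p C : ℝ} (H : Hyp n p C) (k m : ℕ) :
    Ex (om n p) (fun x => ind (∃ Y : Finset (Fin n), Y.card = k ∧ m ≤ arcs x Y)) ≤
      (n.choose k : ℝ) * ((k * k).choose m * p ^ m) := by
  have pt : ∀ x : Fin n → DD n, ind (∃ Y : Finset (Fin n), Y.card = k ∧ m ≤ arcs x Y) ≤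
      ∑ Y ∈ (univ : Finset (Fin n)).powersetCard k, ∑ F ∈ (Y ×ˢ Y).powersetCard m,
        ind (∀ q ∈ F, q.2 ∈ Sd (x q.1)) := by
    intro x
    refine le_trans (ind_mono (Q := ∃ Y ∈ (univ : Finset (Fin n)).powersetCard k,
      ∃ F ∈ (Y ×ˢ Y).powersetCard m, ∀ q ∈ F, q.2 ∈ Sd (x q.1)) ?_)
      ((ind_exists_le _ _).trans (Finset.sum_le_sum fun Y _ => ind_exists_le _ _))
    rintro ⟨Y, hY, hm⟩
    refine ⟨Y, by simp [Finset.mem_powersetCard, hY], ?_⟩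
    obtain ⟨F, hF, hFm⟩ := Finset.exists_subset_card_eq hm
    refine ⟨F, ?_, fun q hq => (Finset.mem_filter.1 (hF hq)).2⟩
    exact Finset.mem_powersetCard.2 ⟨hF.trans (Finset.filter_subset _ _), hFm⟩
  refine (Ex_mono H.om0 pt).trans (le_of_eq ?_)
  rw [Ex_sum]
  have e : ∀ Y ∈ (univ : Finset (Fin n)).powersetCard k,
      Ex (om n p) (fun x => ∑ F ∈ (Y ×ˢ Y).powersetCard m, ind (∀ q ∈ F, q.2 ∈ Sd (x q.1))) =
      (k * k).choose m * p ^ m := by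
    intro Y hY
    rw [Ex_sum]
    rw [Finset.sum_congr rfl (g := fun _ => p ^ m) (fun F hF => by
      rw [Ex_arcs, (Finset.mem_powersetCard.1 hF).2])]
    rw [Finset.sum_const, Finset.card_powersetCard, Finset.card_product,
      (Finset.mem_powersetCard.1 hY).2, nsmul_eq_mul]
  rw [Finset.sum_congr rfl e, Finset.sum_const, Finset.card_powersetCard, Finset.card_univ,
    Fintype.card_fin, nsmul_eq_mul]

lemma choose_exp (a k : ℕ) (hk : 0 < k) : (a.choose k : ℝ) ≤ (Real.exp 1 * a / k) ^ k := by
  refine (Nat.choose_le_pow_div k a).trans ?_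
  have h := Real.pow_div_factorial_le_exp (k:ℝ) (Nat.cast_nonneg k) k
  have hk' : (0:ℝ) < k := by exact_mod_cast hk
  have hf : (0:ℝ) < k.factorial := by exact_mod_cast k.factorial_pos
  have e : Real.exp (k:ℝ) = Real.exp 1 ^ k := by rw [← Real.exp_nat_mul, mul_one]
  rw [e, div_le_iff₀ hf] at h
  rw [div_pow, mul_pow, div_le_div_iff₀ hf (by positivity)]
  calc _ ≤ (a:ℝ) ^ k * (Real.exp 1 ^ k * k.factorial) := by gcongr
    _ = _ := by ring

lemma pow_aux {E C r : ℝ} (hr : 0 < r) (N : ℕ) :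
    (E / r) ^ N * (E * C * r) ^ (N + 1) = E ^ (2 * N + 1) * C ^ (N + 1) * r := by
  have : r ^ N ≠ 0 := (pow_pos hr N).ne'
  rw [div_pow, mul_pow, mul_pow, pow_succ r]
  field_simp
  ring

lemma sparse {n : ℕ} {p C : ℝ} (H : Hyp n p C) {k m : ℕ} (hk : 0 < k) (hkm : 51 * k ≤ 50 * m)
    {η : ℝ} (hkη : (k : ℝ) ≤ η * n) (hη1 : Real.exp 1 * C * η ≤ 1)
    (hη2 : Real.exp 1 ^ 101 * C ^ 51 * η ≤ (1 / 2) ^ 50) :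
    Ex (om n p) (fun x => ind (∃ Y : Finset (Fin n), Y.card = k ∧ m ≤ arcs x Y)) ≤ (1 / 2) ^ k := by
  have hn' : (0:ℝ) < n := by exact_mod_cast H.hn
  have hk' : (0:ℝ) < k := by exact_mod_cast hk
  have hkm' : (k:ℝ) ≤ m := by exact_mod_cast (by omega : k ≤ m)
  have hC := H.hC0
  have he := Real.exp_pos 1
  have chx := choose_exp
  generalize Real.exp 1 = E at hη1 hη2 he chx
  set r : ℝ := k / n with hr
  have hr0 : 0 < r := by positivity
  have hrη : r ≤ η := by rw [hr, div_le_iff₀ hn']; exact hkη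
  have hp0 := H.hp0
  have hpC : p ≤ C / n := by rw [le_div_iff₀ hn']; linarith [H.hnp]
  have b1 : (n.choose k : ℝ) ≤ (E / r) ^ k := by
    refine (chx n k hk).trans (le_of_eq ?_)
    rw [hr]; congr 1; field_simp
  have b2 : ((k * k).choose m : ℝ) * p ^ m ≤ (E * C * r) ^ m := by
    calc _ ≤ (E * (k * k : ℕ) / m) ^ m * (C / n) ^ m := by
          gcongr
          exact chx _ _ (by omega)
      _ = ((E * (k * k : ℕ) / m) * (C / n)) ^ m := by rw [mul_pow]
      _ ≤ _ := by
          refine pow_le_pow_left₀ (by positivity) ?_ m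
          have : (E * (k * k : ℕ) / m) ≤ E * k := by
            rw [div_le_iff₀ (by linarith)]
            push_cast
            have : (k:ℝ) * k ≤ k * m := by gcongr
            nlinarith
          calc _ ≤ E * k * (C / n) := by gcongr
            _ = _ := by rw [hr]; ring
  have hq0 : 0 ≤ E * C * r := by positivity
  have hq1 : E * C * r ≤ 1 := le_trans (by gcongr) hη1
  set Q := (E / r) ^ k * (E * C * r) ^ m with hQ
  have hQ0 : 0 ≤ Q := by positivity
  refine (Ex_dense H k m).trans ((mul_le_mul b1 b2 (by positivity) (by positivity)).trans ?_)
  have h50 : Q ^ 50 ≤ ((1 / 2 : ℝ) ^ k) ^ 50 := by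
    calc Q ^ 50 = (E / r) ^ (50 * k) * (E * C * r) ^ (50 * m) := by
          rw [hQ, mul_pow, ← pow_mul, ← pow_mul, mul_comm k, mul_comm m]
      _ ≤ (E / r) ^ (50 * k) * (E * C * r) ^ (51 * k) := by
          gcongr 1
          exact pow_le_pow_of_le_one hq0 hq1 hkm
      _ = (E ^ 101 * C ^ 51 * r) ^ k := by
          rw [pow_mul, pow_mul, ← mul_pow]
          rw [pow_aux hr0 50]
      _ ≤ ((1 / 2) ^ 50) ^ k := by
          have hz : 0 ≤ E ^ 101 * C ^ 51 := mul_nonneg (pow_nonneg he.le _) (pow_nonneg hC _)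
          exact pow_le_pow_left₀ (mul_nonneg hz hr0.le)
            (le_trans (mul_le_mul_of_nonneg_left hrη hz) hη2) k
      _ = _ := by rw [← pow_mul, ← pow_mul, mul_comm]
  exact (pow_le_pow_iff_left₀ hQ0 (by positivity) (by norm_num)).1 h50

/-- Second moment of in-degrees. -/
lemma indeg2 {n : ℕ} {p C : ℝ} (H : Hyp n p C) :
    Ex (om n p) (fun x : Fin n → DD n => ∑ u : Fin n, (∑ v : Fin n, ind (u ∈ Sd (x v))) ^ 2) ≤ n * (C + C ^ 2) := by
  rw [Ex_sum]
  have one : ∀ u : Fin n, Ex (om n p) (fun x : Fin n → DD n => (∑ v : Fin n, ind (u ∈ Sd (x v))) ^ 2) ≤ C + C ^ 2 := by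
    intro u
    have pr : ∀ v : Fin n, Ex (om n p) (fun x => ind (u ∈ Sd (x v))) = p := by
      intro v
      have := Ex_row_indep (om_sum n p) v (fun d => ind (u ∈ Sd d)) (fun _ => 1) (by intros; rfl)
      simp only [mul_one, om_mem, Ex_const (om_sum n p)] at this
      exact this
    have cr : ∀ v v' : Fin n, Ex (om n p) (fun x => ind (u ∈ Sd (x v)) * ind (u ∈ Sd (x v'))) ≤
        p * ind (v = v') + p * p := by
      intro v v'
      by_cases h : v = v'
      · subst h
        rw [ind_true rfl]
        have : ∀ x : Fin n → DD n, ind (u ∈ Sd (x v)) * ind (u ∈ Sd (x v)) = ind (u ∈ Sd (x v)) := by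
          intro x; rw [← ind_and]; exact ind_congr (by simp)
        simp only [this, pr]
        nlinarith [H.hp0]
      · rw [Ex_row_indep (om_sum n p) v (fun d => ind (u ∈ Sd d)) (fun x => ind (u ∈ Sd (x v')))
          (by intro x d; rw [Function.update_of_ne (Ne.symm h)]), om_mem, pr, ind_false h]
        linarith
    simp only [pow_two, Finset.sum_mul_sum, Ex_sum]
    refine (Finset.sum_le_sum fun v _ => Finset.sum_le_sum fun v' _ => cr v v').trans ?_
    simp only [Finset.sum_add_distrib, ← Finset.mul_sum]
    have : ∀ v : Fin n, ∑ v', ind (v = v') = 1 := by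
      intro v
      rw [Finset.sum_eq_single v]
      · exact ind_true rfl
      · intro b _ hb; exact ind_false (Ne.symm hb)
      · simp
    simp only [this]
    simp
    have h1 := H.hnp
    have h2 : 0 ≤ (n:ℝ) * p := mul_nonneg (Nat.cast_nonneg n) H.hp0
    nlinarith
  refine (Finset.sum_le_sum fun u _ => one u).trans (le_of_eq ?_)
  simp
  ring

/-- The bad set. -/
def BB {n : ℕ} (M T : ℕ) (x : Fin n → DD n) : Finset (Fin n) :=
  univ.filter fun v => col x T v ≠ col x (T + 1) v ∨ M < (Sd (x v)).card

lemma S1 {n : ℕ} {p C : ℝ} (H : Hyp n p C) {M : ℕ} (hM : 0 < M) (T : ℕ) :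
    Ex (om n p) (fun x => ((BB M T x).card : ℝ)) ≤ 0.94 ^ T * n + AA C T + n * C / M := by
  have hM' : (0:ℝ) < M := by exact_mod_cast hM
  have pt : ∀ x : Fin n → DD n, ((BB M T x).card : ℝ) ≤ ∑ v, ind (col x T v ≠ col x (T + 1) v) +
      ∑ v, (1 / M) * ∑ u, ind (u ∈ Sd (x v)) := by
    intro x
    unfold BB
    rw [card_filter_eq_sum_ind, ← Finset.sum_add_distrib]
    refine Finset.sum_le_sum fun v _ => (ind_or_le _ _).trans ?_
    gcongr
    have e : ∑ u, ind (u ∈ Sd (x v)) = (Sd (x v)).card := by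
      rw [← card_filter_eq_sum_ind]; congr 2; ext; simp
    rw [e]
    have := ind_le_div (Nat.cast_nonneg (α := ℝ) (Sd (x v)).card) hM'
    refine (ind_mono fun h => ?_).trans (this.trans (le_of_eq (by ring)))
    exact_mod_cast h.le
  refine (Ex_mono H.om0 pt).trans ?_
  rw [Ex_add]
  refine add_le_add (phase1 H T) ?_
  simp only [Ex_sum, Ex_mul_left]
  have pr : ∀ v u : Fin n, Ex (om n p) (fun x => ind (u ∈ Sd (x v))) = p := by
    intro v u
    have := Ex_row_indep (om_sum n p) v (fun d => ind (u ∈ Sd d)) (fun _ => 1) (by intros; rfl)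
    simp only [mul_one, om_mem, Ex_const (om_sum n p)] at this
    exact this
  simp only [pr]
  simp
  have h1 := H.hnp
  rw [mul_div_assoc]
  refine mul_le_mul_of_nonneg_left ?_ (Nat.cast_nonneg n)
  rw [inv_mul_eq_div]
  gcongr

end WLA

namespace WLA
open Finset

section explore
variable {V K : Type*} [Fintype V] [DecidableEq V] [DecidableEq K]

/-- Exploration process driven by a permutation. -/
def expl (nxt : Equiv.Perm V → Finset V → Option V) (π : Equiv.Perm V) : ℕ → Finset V
  | 0 => ∅
  | j + 1 => match nxt π (expl nxt π j) with
    | none => expl nxt π j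
    | some w => insert w (expl nxt π j)

/-- Locality of an exploration rule. -/
structure NxtOK (nxt : Equiv.Perm V → Finset V → Option V) : Prop where
  new : ∀ π P w, nxt π P = some w → w ∉ P
  loc : ∀ (π π' : Equiv.Perm V) (P : Finset V), (∀ w ∈ P, π w = π' w) → nxt π P = nxt π' P

variable {nxt : Equiv.Perm V → Finset V → Option V}

lemma expl_succ_none {π : Equiv.Perm V} {j : ℕ} (h : nxt π (expl nxt π j) = none) :
    expl nxt π (j + 1) = expl nxt π j := by
  simp [expl, h]

lemma expl_succ_some {π : Equiv.Perm V} {j : ℕ} {w : V} (h : nxt π (expl nxt π j) = some w) :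
    expl nxt π (j + 1) = insert w (expl nxt π j) := by
  simp [expl, h]

lemma expl_sub (π : Equiv.Perm V) (j : ℕ) : expl nxt π j ⊆ expl nxt π (j + 1) := by
  cases h : nxt π (expl nxt π j) with
  | none => rw [expl_succ_none h]
  | some w => rw [expl_succ_some h]; exact Finset.subset_insert _ _

lemma expl_congr (hN : NxtOK nxt) (π π' : Equiv.Perm V) (j : ℕ)
    (h : ∀ w ∈ expl nxt π j, π w = π' w) : expl nxt π' j = expl nxt π j := by
  induction j with
  | zero => rfl
  | succ j ih =>
    have h' : ∀ w ∈ expl nxt π j, π w = π' w := fun w hw => h w (expl_sub π j hw)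
    have e := ih h'
    have e2 : nxt π' (expl nxt π' j) = nxt π (expl nxt π j) := by
      rw [e]; exact (hN.loc _ _ _ h').symm
    cases hh : nxt π (expl nxt π j) with
    | none => rw [expl_succ_none hh, expl_succ_none (e2.trans hh), e]
    | some w => rw [expl_succ_some hh, expl_succ_some (e2.trans hh), e]

lemma expl_card (hN : NxtOK nxt) (π : Equiv.Perm V) (j : ℕ) :
    (expl nxt π j).card = j ∨ ((expl nxt π j).card ≤ j ∧ nxt π (expl nxt π j) = none) := by
  induction j with
  | zero => left; rfl
  | succ j ih =>
    cases hh : nxt π (expl nxt π j) with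
    | none =>
      right
      rw [expl_succ_none hh]
      refine ⟨?_, hh⟩
      rcases ih with h | h
      · omega
      · omega
    | some w =>
      rcases ih with h | h
      · left
        rw [expl_succ_some hh, Finset.card_insert_of_notMem (hN.new _ _ _ hh), h]
      · rw [h.2] at hh; cases hh

/-- Class-preserving permutations. -/
def Gp (τ : V → K) : Finset (Equiv.Perm V) := univ.filter fun π => ∀ v, τ (π v) = τ v

lemma mem_Gp {τ : V → K} {π : Equiv.Perm V} : π ∈ Gp τ ↔ ∀ v, τ (π v) = τ v := by simp [Gp]

lemma Gp_card_pos (τ : V → K) : 0 < (Gp τ).card :=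
  Finset.card_pos.2 ⟨1, by simp [Gp]⟩

noncomputable def sE (nxt : Equiv.Perm V → Finset V → Option V) (ψ : V → ℝ) (j : ℕ)
    (π : Equiv.Perm V) : ℝ := ∑ w ∈ expl nxt π j, ψ (π w)

/-- Next-step increment. -/
noncomputable def chi (nxt : Equiv.Perm V → Finset V → Option V) (ψ : V → ℝ) (j : ℕ)
    (π : Equiv.Perm V) : ℝ := match nxt π (expl nxt π j) with
    | none => 0
    | some w => ψ (π w)

lemma sE_succ (hN : NxtOK nxt) (ψ : V → ℝ) (j : ℕ) (π : Equiv.Perm V) :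
    sE nxt ψ (j + 1) π = sE nxt ψ j π + chi nxt ψ j π := by
  unfold sE chi
  cases hh : nxt π (expl nxt π j) with
  | none => rw [expl_succ_none hh]; simp
  | some w => rw [expl_succ_some hh, Finset.sum_insert (hN.new _ _ _ hh)]; simp [add_comm]

lemma swap_cond (hN : NxtOK nxt) {τ : V → K} {h : K} {j : ℕ} {π : Equiv.Perm V} {w w' : V}
    (hπ : π ∈ Gp τ) (hw : nxt π (expl nxt π j) = some w) (hwh : τ w = h) (hw'h : τ w' = h)
    (hw' : w' ∉ expl nxt π j) :
    π * Equiv.swap w w' ∈ Gp τ ∧ expl nxt (π * Equiv.swap w w') j = expl nxt π j ∧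
    nxt (π * Equiv.swap w w') (expl nxt (π * Equiv.swap w w') j) = some w ∧
    ∀ ψ, sE nxt ψ j (π * Equiv.swap w w') = sE nxt ψ j π := by
  have hwn := hN.new _ _ _ hw
  have ag : ∀ u ∈ expl nxt π j, π u = (π * Equiv.swap w w') u := by
    intro u hu
    rw [Equiv.Perm.mul_apply, Equiv.swap_apply_of_ne_of_ne]
    · rintro rfl; exact hwn hu
    · rintro rfl; exact hw' hu
  have e := expl_congr hN π _ j ag
  refine ⟨?_, e, ?_, ?_⟩
  · rw [mem_Gp] at hπ ⊢
    intro v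
    rw [Equiv.Perm.mul_apply, hπ]
    by_cases h1 : v = w
    · subst h1; rw [Equiv.swap_apply_left, hw'h, hwh]
    · by_cases h2 : v = w'
      · subst h2; rw [Equiv.swap_apply_right, hw'h, hwh]
      · rw [Equiv.swap_apply_of_ne_of_ne h1 h2]
  · rw [e, ← hN.loc _ _ _ ag, hw]
  · intro ψ
    unfold sE
    rw [e]
    exact Finset.sum_congr rfl fun u hu => by rw [ag u hu]

lemma cross_le (hN : NxtOK nxt) (τ : V → K) (h : K) (ψ : V → ℝ) (hψ : ∀ u, τ u ≠ h → ψ u = 0)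
    (hψ0 : ∑ u, ψ u = 0) (j : ℕ) :
    ∑ π ∈ Gp τ, sE nxt ψ j π * chi nxt ψ j π ≤ 0 := by
  classical
  -- the set of relevant permutations
  set Q : Equiv.Perm V → Finset V := fun π => univ.filter fun w' => τ w' = h ∧ w' ∉ expl nxt π j
    with hQ
  set F : Finset (Equiv.Perm V) := (Gp τ).filter fun π =>
    ∃ w, nxt π (expl nxt π j) = some w ∧ τ w = h with hF
  have e1 : ∑ π ∈ Gp τ, sE nxt ψ j π * chi nxt ψ j π = ∑ π ∈ F, sE nxt ψ j π * chi nxt ψ j π := by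
    rw [hF, Finset.sum_filter]
    refine Finset.sum_congr rfl fun π hπ => ?_
    split_ifs with hc
    · rfl
    · have : chi nxt ψ j π = 0 := by
        unfold chi
        cases hh : nxt π (expl nxt π j) with
        | none => rfl
        | some w =>
          refine hψ _ fun hw => hc ⟨w, hh, ?_⟩
          rw [← hw, mem_Gp.1 hπ]
      rw [this, mul_zero]
  have hQpos : ∀ π ∈ F, (0:ℝ) < (Q π).card := by
    intro π hπ
    obtain ⟨-, w, hw, hwh⟩ := Finset.mem_filter.1 hπ
    have : w ∈ Q π := by simp [hQ, hwh, hN.new _ _ _ hw]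
    exact_mod_cast Finset.card_pos.2 ⟨w, this⟩
  have e2 : ∑ π ∈ F, sE nxt ψ j π * chi nxt ψ j π =
      ∑ π ∈ F, ∑ w' ∈ Q π, sE nxt ψ j π * chi nxt ψ j π / (Q π).card := by
    refine Finset.sum_congr rfl fun π hπ => ?_
    rw [Finset.sum_const, nsmul_eq_mul]
    have := hQpos π hπ
    field_simp
  have e3 : ∑ π ∈ F, ∑ w' ∈ Q π, sE nxt ψ j π * chi nxt ψ j π / (Q π).card =
      ∑ π ∈ F, ∑ w' ∈ Q π, sE nxt ψ j π * ψ (π w') / (Q π).card := by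
    have flip : ∀ f : Equiv.Perm V → V → ℝ, ∑ π ∈ F, ∑ w' ∈ Q π, f π w' =
        ∑ w', ∑ π ∈ F.filter (fun π => w' ∈ Q π), f π w' := by
      intro f
      rw [Finset.sum_comm' (s' := fun w' => F.filter (fun π => w' ∈ Q π)) (t' := univ)]
      intro π w'; simp
    rw [flip, flip]
    refine Finset.sum_congr rfl fun w' _ => ?_
    set Φ : Equiv.Perm V → Equiv.Perm V := fun π =>
      π * Equiv.swap ((nxt π (expl nxt π j)).getD w') w' with hΦ
    have main : ∀ π ∈ F.filter (fun π => w' ∈ Q π), Φ π ∈ F.filter (fun π => w' ∈ Q π) ∧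
        Φ (Φ π) = π ∧ sE nxt ψ j π * chi nxt ψ j π / (Q π).card =
          sE nxt ψ j (Φ π) * ψ (Φ π w') / (Q (Φ π)).card := by
      intro π hπ
      obtain ⟨hπF, hwQ⟩ := Finset.mem_filter.1 hπ
      obtain ⟨hπG, w, hw, hwh⟩ := Finset.mem_filter.1 hπF
      simp only [hQ, Finset.mem_filter, Finset.mem_univ, true_and] at hwQ
      obtain ⟨c1, c2, c3, c4⟩ := swap_cond hN hπG hw hwh hwQ.1 hwQ.2
      have hΦπ : Φ π = π * Equiv.swap w w' := by simp [hΦ, hw]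
      have hΦ2 : Φ (π * Equiv.swap w w') = π := by
        simp [hΦ, c3, mul_assoc]
      have hchi : chi nxt ψ j π = ψ (π w) := by simp [chi, hw]
      have hQe : Q (π * Equiv.swap w w') = Q π := by simp only [hQ, c2]
      rw [hΦπ]
      refine ⟨?_, hΦ2, ?_⟩
      · refine Finset.mem_filter.2 ⟨Finset.mem_filter.2 ⟨c1, w, c3, hwh⟩, ?_⟩
        rw [hQe]; simp [hQ, hwQ.1, hwQ.2]
      · rw [hQe, c4, hchi, Equiv.Perm.mul_apply, Equiv.swap_apply_right]
    exact Finset.sum_nbij' Φ Φ (fun π hπ => (main π hπ).1) (fun π hπ => (main π hπ).1)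
      (fun π hπ => (main π hπ).2.1) (fun π hπ => (main π hπ).2.1) (fun π hπ => (main π hπ).2.2)
  rw [e1, e2, e3]
  refine Finset.sum_nonpos fun π hπ => ?_
  rw [← Finset.sum_div, ← Finset.mul_sum]
  have hG : π ∈ Gp τ := (Finset.mem_filter.1 hπ).1
  have : ∑ w' ∈ Q π, ψ (π w') = - sE nxt ψ j π := by
    have a1 : ∑ w', ψ (π w') = 0 := by rw [Equiv.sum_comp π ψ, hψ0]
    have a2 : ∑ w' ∈ Q π, ψ (π w') = ∑ w' ∈ univ \ expl nxt π j, ψ (π w') := by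
      refine Finset.sum_subset (fun w hw => by simp [hQ] at hw ⊢; exact hw.2) ?_
      intro w hw hw2
      refine hψ _ fun hh => hw2 ?_
      rw [mem_Gp.1 hG] at hh
      simp at hw
      simp [hQ, hw, hh]
    have a3 := Finset.sum_sdiff (Finset.subset_univ (expl nxt π j)) (f := fun w => ψ (π w))
    rw [a2]; unfold sE; linarith
  rw [this]
  have := hQpos π hπ
  refine div_nonpos_of_nonpos_of_nonneg ?_ this.le
  nlinarith [sq_nonneg (sE nxt ψ j π)]

lemma lemE (hN : NxtOK nxt) (τ : V → K) (h : K) (ψ : V → ℝ) (hψ : ∀ u, τ u ≠ h → ψ u = 0)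
    (hψ0 : ∑ u, ψ u = 0) (j : ℕ) :
    ∑ π ∈ Gp τ, sE nxt ψ j π ^ 2 ≤ (Gp τ).card * ∑ u, ψ u ^ 2 := by
  have step : ∀ j, ∑ π ∈ Gp τ, sE nxt ψ j π ^ 2 ≤ ∑ π ∈ Gp τ, sE nxt (fun u => ψ u ^ 2) j π := by
    intro j
    induction j with
    | zero => simp [sE, expl]
    | succ j ih =>
      have c := cross_le hN τ h ψ hψ hψ0 j
      have e : ∀ π, chi nxt ψ j π ^ 2 = chi nxt (fun u => ψ u ^ 2) j π := by
        intro π; unfold chi; cases nxt π (expl nxt π j) <;> simp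
      calc _ = ∑ π ∈ Gp τ, (sE nxt ψ j π ^ 2 + 2 * (sE nxt ψ j π * chi nxt ψ j π) +
            chi nxt (fun u => ψ u ^ 2) j π) := by
            refine Finset.sum_congr rfl fun π _ => ?_
            rw [sE_succ hN, ← e]; ring
        _ = ∑ π ∈ Gp τ, sE nxt ψ j π ^ 2 + 2 * ∑ π ∈ Gp τ, sE nxt ψ j π * chi nxt ψ j π +
            ∑ π ∈ Gp τ, chi nxt (fun u => ψ u ^ 2) j π := by
            rw [Finset.sum_add_distrib, Finset.sum_add_distrib, Finset.mul_sum]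
        _ ≤ ∑ π ∈ Gp τ, sE nxt (fun u => ψ u ^ 2) j π +
            ∑ π ∈ Gp τ, chi nxt (fun u => ψ u ^ 2) j π := by linarith
        _ = _ := by
            rw [← Finset.sum_add_distrib]
            exact Finset.sum_congr rfl fun π _ => (sE_succ hN _ _ _).symm
  refine (step j).trans ?_
  rw [← nsmul_eq_mul]
  refine Finset.sum_le_card_nsmul _ _ _ fun π _ => ?_
  unfold sE
  rw [← Equiv.sum_comp π (fun u => ψ u ^ 2)]
  exact Finset.sum_le_sum_of_subset_of_nonneg (Finset.subset_univ _) fun _ _ _ => sq_nonneg _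

/-- Chebyshev for the exploration. -/
lemma lemE_cheb (hN : NxtOK nxt) (τ : V → K) (h : K) (ψ : V → ℝ) (hψ : ∀ u, τ u ≠ h → ψ u = 0)
    (hψ0 : ∑ u, ψ u = 0) (j : ℕ) {y : ℝ} (hy : 0 < y) :
    (∑ π ∈ Gp τ, ind (y ≤ sE nxt ψ j π)) / (Gp τ).card ≤ (∑ u, ψ u ^ 2) / y ^ 2 := by
  have hG : (0:ℝ) < (Gp τ).card := by exact_mod_cast Gp_card_pos τ
  rw [div_le_div_iff₀ hG (by positivity)]
  have : (∑ π ∈ Gp τ, ind (y ≤ sE nxt ψ j π)) * y ^ 2 ≤ ∑ π ∈ Gp τ, sE nxt ψ j π ^ 2 := by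
    rw [Finset.sum_mul]
    refine Finset.sum_le_sum fun π _ => ?_
    by_cases hc : y ≤ sE nxt ψ j π
    · rw [ind_true hc, one_mul]; gcongr
    · rw [ind_false hc, zero_mul]; positivity
  linarith [lemE hN τ h ψ hψ hψ0 j]

end explore
end WLA

namespace WLA
open Finset

def actd {n : ℕ} (π : Equiv.Perm (Fin n)) (d : DD n) : DD n := (d.1, fun w => d.2 (π w))

def act {n : ℕ} (π : Equiv.Perm (Fin n)) (x : Fin n → DD n) : Fin n → DD n :=
  fun v => actd π (x v)

lemma mem_actd {n : ℕ} {π : Equiv.Perm (Fin n)} {d : DD n} {w : Fin n} :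
    w ∈ Sd (actd π d) ↔ π w ∈ Sd d := by simp [mem_Sd, actd]

lemma actd_card {n : ℕ} (π : Equiv.Perm (Fin n)) (d : DD n) :
    (Sd (actd π d)).card = (Sd d).card := by
  refine Finset.card_bij (fun w _ => π w) (fun w hw => mem_actd.1 hw)
    (fun a _ b _ h => π.injective h) (fun b hb => ⟨π.symm b, ?_, by simp⟩)
  rw [mem_actd]; simpa using hb

lemma actd_cnt {n : ℕ} (π : Equiv.Perm (Fin n)) (d : DD n) (c : Fin n → Fin 3)
    (hc : ∀ v, c (π v) = c v) (a : Fin 3) : cnt (actd π d) c a = cnt d c a := by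
  unfold cnt
  refine Finset.card_bij (fun w _ => π w) ?_
    (fun a _ b _ h => π.injective h) (fun b hb => ⟨π.symm b, ?_, by simp⟩)
  · intro w hw
    rw [Finset.mem_filter, mem_actd] at hw
    rw [Finset.mem_filter, hc]
    exact hw
  · rw [Finset.mem_filter, mem_actd, ← hc]; simpa using hb

lemma actd_rule {n : ℕ} (π : Equiv.Perm (Fin n)) (d : DD n) (c : Fin n → Fin 3)
    (hc : ∀ v, c (π v) = c v) : rule (actd π d) c = rule d c := by
  unfold rule
  rw [actd_card, actd_cnt π d c hc]
  rfl

lemma actd_sens {n : ℕ} (π : Equiv.Perm (Fin n)) (d : DD n) (c : Fin n → Fin 3)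
    (hc : ∀ v, c (π v) = c v) (w : Fin n) : sens (actd π d) c w ↔ sens d c (π w) := by
  unfold sens
  rw [actd_rule π d c hc, actd_card, actd_cnt π d c hc, hc]

lemma Gp_col {n T : ℕ} {x : Fin n → DD n} {π : Equiv.Perm (Fin n)} (hπ : π ∈ Gp (hist T x))
    {i : ℕ} (hi : i ≤ T) (v : Fin n) : col x i (π v) = col x i v := by
  have := congrFun (mem_Gp.1 hπ v) ⟨i, by omega⟩
  exact this

lemma act_col {n T : ℕ} {x : Fin n → DD n} {π : Equiv.Perm (Fin n)} (hπ : π ∈ Gp (hist T x))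
    (i : ℕ) (hi : i ≤ T + 1) : col (act π x) i = col x i := by
  induction i with
  | zero => rfl
  | succ i ih =>
    have e := ih (by omega)
    funext v
    change rule (actd π (x v)) (col (act π x) i) = rule (x v) (col x i)
    rw [e, actd_rule π _ _ (fun v => Gp_col hπ (by omega) v)]

lemma act_hist {n T : ℕ} {x : Fin n → DD n} {π : Equiv.Perm (Fin n)} (hπ : π ∈ Gp (hist T x)) :
    hist T (act π x) = hist T x := by
  funext v i
  change col (act π x) i v = col x i v
  rw [act_col hπ i (by omega)]

lemma act_BB {n M T : ℕ} {x : Fin n → DD n} {π : Equiv.Perm (Fin n)} (hπ : π ∈ Gp (hist T x)) :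
    BB M T (act π x) = BB M T x := by
  unfold BB
  rw [act_col hπ T (by omega), act_col hπ (T + 1) le_rfl]
  congr 1
  funext v
  rw [show act π x v = actd π (x v) from rfl, actd_card]

lemma act_inv {n : ℕ} (π : Equiv.Perm (Fin n)) (x : Fin n → DD n) : act π (act π⁻¹ x) = x := by
  funext v; simp [act, actd]

lemma act_inv' {n : ℕ} (π : Equiv.Perm (Fin n)) (x : Fin n → DD n) : act π⁻¹ (act π x) = x := by
  funext v; simp [act, actd]

lemma om_actd {n : ℕ} (p : ℝ) (π : Equiv.Perm (Fin n)) (d : DD n) : om n p (actd π d) = om n p d := by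
  unfold om wt actd
  simp only
  rw [Equiv.prod_comp π (fun w => bw p (d.2 w))]

lemma wt_act {n : ℕ} (p : ℝ) (π : Equiv.Perm (Fin n)) (x : Fin n → DD n) :
    wt (om n p) (act π x) = wt (om n p) x := by
  unfold wt act
  simp only [om_actd]

lemma Gp_inv {V K : Type*} [Fintype V] [DecidableEq V] [DecidableEq K] {τ : V → K} {π : Equiv.Perm V} (h : π ∈ Gp τ) : π⁻¹ ∈ Gp τ := by
  rw [mem_Gp] at h ⊢
  intro v
  rw [← h (π⁻¹ v)]; simp

/-- Averaging over type-preserving permutations. -/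
lemma Ex_avg {n : ℕ} (p : ℝ) (T : ℕ) (F : (Fin n → DD n) → ℝ) :
    Ex (om n p) (fun x => (∑ π ∈ Gp (hist T x), F (act π x)) / (Gp (hist T x)).card) =
      Ex (om n p) F := by
  unfold Ex
  have e : ∀ G : (Fin n → DD n) → Equiv.Perm (Fin n) → ℝ,
      ∑ x, ∑ π ∈ Gp (hist T x), G x π = ∑ π, ∑ x ∈ univ.filter (fun x => π ∈ Gp (hist T x)), G x π := by
    intro G
    rw [Finset.sum_comm' (s' := fun π => univ.filter (fun x => π ∈ Gp (hist T x))) (t' := univ)]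
    intro x π; simp
  calc _ = ∑ x, ∑ π ∈ Gp (hist T x), wt (om n p) x * F (act π x) / (Gp (hist T x)).card := by
        refine Finset.sum_congr rfl fun x _ => ?_
        rw [← Finset.sum_div, ← Finset.mul_sum, mul_div_assoc]
    _ = ∑ x, ∑ π ∈ Gp (hist T x), wt (om n p) x * F x / (Gp (hist T x)).card := by
        rw [e, e]
        refine Finset.sum_congr rfl fun π _ => ?_
        refine Finset.sum_nbij' (act π) (act π⁻¹) ?_ ?_ (fun x _ => act_inv' π x)
          (fun x _ => act_inv π x) ?_
        · intro x hx
          simp only [Finset.mem_filter, Finset.mem_univ, true_and] at hx ⊢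
          rwa [act_hist hx]
        · intro x hx
          simp only [Finset.mem_filter, Finset.mem_univ, true_and] at hx ⊢
          rwa [act_hist (Gp_inv hx)]
        · intro x hx
          simp only [Finset.mem_filter, Finset.mem_univ, true_and] at hx
          rw [wt_act, act_hist hx]
    _ = _ := by
        refine Finset.sum_congr rfl fun x _ => ?_
        rw [Finset.sum_const, nsmul_eq_mul]
        have hG : (0:ℝ) < (Gp (hist T x)).card := by exact_mod_cast Gp_card_pos _
        field_simp

/-- Touching. -/
def touch {n : ℕ} (T : ℕ) (x : Fin n → DD n) (P : Finset (Fin n)) (v : Fin n) : Prop :=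
  (∃ w ∈ P, w ∈ Sd (x v) ∧ sens (x v) (col x T) w) ∨ 2 ≤ #{w ∈ P | w ∈ Sd (x v)}

lemma touch_mono {n T : ℕ} {x : Fin n → DD n} {P Q : Finset (Fin n)} (h : P ⊆ Q) {v : Fin n}
    (ht : touch T x P v) : touch T x Q v := by
  rcases ht with ⟨w, hw, h1⟩ | h2
  · exact Or.inl ⟨w, h hw, h1⟩
  · exact Or.inr (h2.trans (Finset.card_le_card (Finset.filter_subset_filter _ h)))

/-- Closed sets. -/
def Closed {n : ℕ} (M T : ℕ) (x : Fin n → DD n) (P : Finset (Fin n)) : Prop :=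
  ∀ v, v ∉ P → v ∉ BB M T x ∧ ¬ touch T x P v

/-- Touching in the permuted digraph, expressed with the original data. -/
def touchp {n : ℕ} (T : ℕ) (x : Fin n → DD n) (π : Equiv.Perm (Fin n)) (P : Finset (Fin n))
    (v : Fin n) : Prop :=
  (∃ w ∈ P, π w ∈ Sd (x v) ∧ sens (x v) (col x T) (π w)) ∨ 2 ≤ #{w ∈ P | π w ∈ Sd (x v)}

lemma touch_act {n T : ℕ} {x : Fin n → DD n} {π : Equiv.Perm (Fin n)} (hπ : π ∈ Gp (hist T x))
    (P : Finset (Fin n)) (v : Fin n) : touch T (act π x) P v ↔ touchp T x π P v := by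
  unfold touch touchp
  rw [act_col hπ T (by omega)]
  simp only [act, mem_actd, actd_sens π _ _ (fun v => Gp_col hπ le_rfl v)]

open Classical in
/-- The next vertex to be explored. -/
noncomputable def nxtv {n : ℕ} (M T : ℕ) (x : Fin n → DD n) (π : Equiv.Perm (Fin n))
    (P : Finset (Fin n)) : Option (Fin n) :=
  if h : ∃ v, v ∉ P ∧ (v ∈ BB M T x ∨ touchp T x π P v) then some h.choose else none

lemma nxtv_spec {n M T : ℕ} {x : Fin n → DD n} {π : Equiv.Perm (Fin n)} {P : Finset (Fin n)}
    {v : Fin n} (h : nxtv M T x π P = some v) : v ∉ P ∧ (v ∈ BB M T x ∨ touchp T x π P v) := by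
  unfold nxtv at h
  split_ifs at h with hc
  injection h with h
  subst h
  exact hc.choose_spec

lemma nxtv_ok {n : ℕ} (M T : ℕ) (x : Fin n → DD n) : NxtOK (nxtv M T x) where
  new := fun π P w h => (nxtv_spec h).1
  loc := by
    intro π π' P h
    have : touchp T x π P = touchp T x π' P := by
      funext v
      unfold touchp
      have e1 : {w ∈ P | π w ∈ Sd (x v)} = {w ∈ P | π' w ∈ Sd (x v)} :=
        Finset.filter_congr fun w hw => by rw [h w hw]
      rw [e1]
      congr 1
      refine propext (exists_congr fun w => and_congr_right fun hw => by rw [h w hw])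
    unfold nxtv
    rw [this]

lemma nxtv_none {n M T : ℕ} {x : Fin n → DD n} {π : Equiv.Perm (Fin n)} (hπ : π ∈ Gp (hist T x))
    {P : Finset (Fin n)} (h : nxtv M T x π P = none) : Closed M T (act π x) P := by
  unfold nxtv at h
  split_ifs at h with hc
  push Not at hc
  intro v hv
  rw [act_BB hπ, touch_act hπ]
  exact hc v hv

lemma expl_touch {n M T : ℕ} {x : Fin n → DD n} {π : Equiv.Perm (Fin n)} (hπ : π ∈ Gp (hist T x))
    (j : ℕ) : ∀ v ∈ expl (nxtv M T x) π j, v ∈ BB M T x ∨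
      touch T (act π x) (expl (nxtv M T x) π j) v := by
  induction j with
  | zero => intro v hv; simp [expl] at hv
  | succ j ih =>
    cases hh : nxtv M T x π (expl (nxtv M T x) π j) with
    | none => rw [expl_succ_none hh]; exact ih
    | some w =>
      intro v hv
      have hs := expl_sub (nxt := nxtv M T x) π j
      by_cases hv' : v ∈ expl (nxtv M T x) π j
      · exact (ih v hv').imp_right (touch_mono hs)
      · rw [expl_succ_some hh, Finset.mem_insert] at hv
        obtain rfl := hv.resolve_right hv'
        refine (nxtv_spec hh).2.imp_right fun h => touch_mono hs ?_
        rwa [touch_act hπ]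

end WLA

namespace WLA
open Finset

noncomputable def sn {n : ℕ} (M T : ℕ) (x : Fin n → DD n) (u : Fin n) : ℝ :=
  ∑ v, ind ((Sd (x v)).card ≤ M ∧ u ∈ Sd (x v) ∧ sens (x v) (col x T) u)

lemma sn_nonneg {n : ℕ} (M T : ℕ) (x : Fin n → DD n) (u : Fin n) : 0 ≤ sn M T x u :=
  Finset.sum_nonneg fun _ _ => ind_nonneg _

lemma sn_le {n : ℕ} (M T : ℕ) (x : Fin n → DD n) (u : Fin n) :
    sn M T x u ≤ ∑ v, ind (u ∈ Sd (x v)) :=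
  Finset.sum_le_sum fun _ _ => ind_mono fun h => h.2.1

lemma sn_act {n M T : ℕ} {x : Fin n → DD n} {π : Equiv.Perm (Fin n)} (hπ : π ∈ Gp (hist T x))
    (u : Fin n) : sn M T (act π x) u = sn M T x (π u) := by
  unfold sn
  rw [act_col hπ T (by omega)]
  simp only [act, mem_actd, actd_sens π _ _ (fun v => Gp_col hπ le_rfl v), actd_card]

lemma contr_sum {n : ℕ} (M T : ℕ) (h : Fin (T + 1) → Fin 3) (x : Fin n → DD n) :
    ∑ v, contr M T h (x v) x = ∑ u, ind (hist T x u = h) * sn M T x u := by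
  unfold contr sn
  rw [Finset.sum_comm]
  refine Finset.sum_congr rfl fun u _ => ?_
  rw [Finset.mul_sum]
  exact Finset.sum_congr rfl fun v _ => mul_comm _ _

lemma count {n M T : ℕ} (y : Fin n → DD n) (Y : Finset (Fin n))
    (hY : ∀ v ∈ Y, v ∈ BB M T y ∨ touch T y Y v) :
    2 * (Y.card : ℝ) ≤ 2 * (BB M T y).card + ∑ w ∈ Y, sn M T y w + arcs y Y := by
  have ha : (arcs y Y : ℝ) = ∑ v ∈ Y, ((#{w ∈ Y | w ∈ Sd (y v)} : ℕ) : ℝ) := by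
    unfold arcs
    rw [← Nat.cast_sum]
    congr 1
    rw [Finset.card_filter, Finset.sum_product]
    exact Finset.sum_congr rfl fun v _ => by rw [Finset.card_filter]
  have hs : ∑ v ∈ Y, ∑ w ∈ Y, ind ((Sd (y v)).card ≤ M ∧ w ∈ Sd (y v) ∧ sens (y v) (col y T) w) ≤
      ∑ w ∈ Y, sn M T y w := by
    rw [Finset.sum_comm]
    refine Finset.sum_le_sum fun w _ => ?_
    exact Finset.sum_le_sum_of_subset_of_nonneg (Finset.subset_univ _) fun _ _ _ => ind_nonneg _
  have hb : ∑ v ∈ Y, ind (v ∈ BB M T y) ≤ (BB M T y).card := by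
    rw [← card_filter_eq_sum_ind]
    exact_mod_cast Finset.card_le_card fun v hv => (Finset.mem_filter.1 hv).2
  have key : ∑ v ∈ Y, (2:ℝ) ≤ ∑ v ∈ Y, (2 * ind (v ∈ BB M T y) +
      ∑ w ∈ Y, ind ((Sd (y v)).card ≤ M ∧ w ∈ Sd (y v) ∧ sens (y v) (col y T) w) +
      ((#{w ∈ Y | w ∈ Sd (y v)} : ℕ) : ℝ)) := by
    refine Finset.sum_le_sum fun v hv => ?_
    have n1 : 0 ≤ ∑ w ∈ Y, ind ((Sd (y v)).card ≤ M ∧ w ∈ Sd (y v) ∧ sens (y v) (col y T) w) :=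
      Finset.sum_nonneg fun _ _ => ind_nonneg _
    have n2 : (0:ℝ) ≤ ((#{w ∈ Y | w ∈ Sd (y v)} : ℕ) : ℝ) := Nat.cast_nonneg _
    by_cases hB : v ∈ BB M T y
    · rw [ind_true hB]; linarith
    · have hM : (Sd (y v)).card ≤ M := by
        by_contra hc
        exact hB (by simp only [BB, Finset.mem_filter, Finset.mem_univ, true_and]; right; omega)
      rw [ind_false hB]
      rcases (hY v hv).resolve_left hB with ⟨w, hw, h1, h2⟩ | h2
      · have m1 : (1:ℝ) ≤ ∑ w ∈ Y, ind ((Sd (y v)).card ≤ M ∧ w ∈ Sd (y v) ∧ sens (y v) (col y T) w) := by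
          rw [← ind_true (⟨hM, h1, h2⟩ : (Sd (y v)).card ≤ M ∧ w ∈ Sd (y v) ∧ sens (y v) (col y T) w)]
          exact Finset.single_le_sum (f := fun w => ind ((Sd (y v)).card ≤ M ∧ w ∈ Sd (y v) ∧
            sens (y v) (col y T) w)) (fun _ _ => ind_nonneg _) hw
        have m2 : (1:ℝ) ≤ ((#{w ∈ Y | w ∈ Sd (y v)} : ℕ) : ℝ) := by
          have : 0 < #{w ∈ Y | w ∈ Sd (y v)} := Finset.card_pos.2 ⟨w, by simp [hw, h1]⟩
          exact_mod_cast this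
        linarith
      · have m2 : (2:ℝ) ≤ ((#{w ∈ Y | w ∈ Sd (y v)} : ℕ) : ℝ) := by exact_mod_cast h2
        linarith
  rw [Finset.sum_add_distrib, Finset.sum_add_distrib, ← Finset.mul_sum, ← ha, Finset.sum_const,
    nsmul_eq_mul] at key
  linarith

/-- Class size, class sensitivity sum, class mean and centred sensitivity. -/
noncomputable def Nh {n : ℕ} (T : ℕ) (x : Fin n → DD n) (h : Fin (T + 1) → Fin 3) : ℝ :=
  ∑ u, ind (hist T x u = h)
noncomputable def Sh {n : ℕ} (M T : ℕ) (x : Fin n → DD n) (h : Fin (T + 1) → Fin 3) : ℝ :=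
  ∑ u, ind (hist T x u = h) * sn M T x u
noncomputable def psi {n : ℕ} (M T : ℕ) (x : Fin n → DD n) (h : Fin (T + 1) → Fin 3) (u : Fin n) : ℝ :=
  ind (hist T x u = h) * (sn M T x u - Sh M T x h / Nh T x h)

lemma ind_sq (P : Prop) : ind P * ind P = ind P := by rw [← ind_and]; exact ind_congr (by simp)

lemma Nh_zero {n M T : ℕ} {x : Fin n → DD n} {h : Fin (T + 1) → Fin 3} (h0 : Nh T x h = 0) :
    Sh M T x h = 0 := by
  unfold Nh at h0
  rw [Finset.sum_eq_zero_iff_of_nonneg (fun _ _ => ind_nonneg _)] at h0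
  unfold Sh
  exact Finset.sum_eq_zero fun u hu => by rw [h0 u hu, zero_mul]

lemma psi_sum {n : ℕ} (M T : ℕ) (x : Fin n → DD n) (h : Fin (T + 1) → Fin 3) :
    ∑ u, psi M T x h u = 0 := by
  unfold psi
  simp only [mul_sub, Finset.sum_sub_distrib, ← Finset.sum_mul]
  change Sh M T x h - Nh T x h * (Sh M T x h / Nh T x h) = 0
  by_cases h0 : Nh T x h = 0
  · rw [Nh_zero h0, h0]; simp
  · field_simp; simp

lemma psi_sq {n : ℕ} (M T : ℕ) (x : Fin n → DD n) (h : Fin (T + 1) → Fin 3) :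
    ∑ u, psi M T x h u ^ 2 ≤ ∑ u, (∑ v, ind (u ∈ Sd (x v))) ^ 2 := by
  have e : ∀ u, psi M T x h u ^ 2 = ind (hist T x u = h) * sn M T x u ^ 2 -
      psi M T x h u * (Sh M T x h / Nh T x h) -
      (Sh M T x h / Nh T x h) * (ind (hist T x u = h) * sn M T x u) := by
    intro u
    unfold psi
    have := ind_sq (hist T x u = h)
    rw [mul_pow, pow_two (ind _), this]; ring
  have h1 : 0 ≤ (Sh M T x h / Nh T x h) * Sh M T x h := by
    have a : 0 ≤ Sh M T x h := Finset.sum_nonneg fun u _ => mul_nonneg (ind_nonneg _) (sn_nonneg _ _ _ _)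
    have b : 0 ≤ Nh T x h := Finset.sum_nonneg fun u _ => ind_nonneg _
    positivity
  calc _ = ∑ u, ind (hist T x u = h) * sn M T x u ^ 2 - (Sh M T x h / Nh T x h) * Sh M T x h := by
        simp only [e, Finset.sum_sub_distrib, ← Finset.sum_mul, psi_sum, ← Finset.mul_sum]
        unfold Sh; ring
    _ ≤ ∑ u, ind (hist T x u = h) * sn M T x u ^ 2 := by linarith
    _ ≤ _ := by
        refine Finset.sum_le_sum fun u _ => ?_
        calc _ ≤ 1 * sn M T x u ^ 2 := by gcongr; exact ind_le_one _
          _ ≤ _ := by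
            rw [one_mul]
            exact pow_le_pow_left₀ (sn_nonneg _ _ _ _) (sn_le _ _ _ _) 2

lemma sn_decomp {n M T : ℕ} {x : Fin n → DD n} {π : Equiv.Perm (Fin n)} (hπ : π ∈ Gp (hist T x))
    (Y : Finset (Fin n)) {t : ℝ} (ht : 0 ≤ t)
    (hS : ∀ h, Sh M T x h ≤ 0.94 * Nh T x h + t) :
    ∑ w ∈ Y, sn M T x (π w) ≤ 0.94 * Y.card + Fintype.card (Fin (T + 1) → Fin 3) * t +
      ∑ h, ∑ w ∈ Y, psi M T x h (π w) := by
  have one : ∀ u : Fin n, ∑ h, ind (hist T x u = h) = 1 := by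
    intro u
    rw [Finset.sum_eq_single (hist T x u)]
    · exact ind_true rfl
    · intro b _ hb; exact ind_false (Ne.symm hb)
    · simp
  have e : ∀ u, sn M T x u = ∑ h, (psi M T x h u + ind (hist T x u = h) * (Sh M T x h / Nh T x h)) := by
    intro u
    have : ∀ h, psi M T x h u + ind (hist T x u = h) * (Sh M T x h / Nh T x h) =
        ind (hist T x u = h) * sn M T x u := by intro h; unfold psi; ring
    simp only [this, ← Finset.sum_mul, one, one_mul]
  have e2 : ∑ w ∈ Y, sn M T x (π w) = ∑ h, ∑ w ∈ Y, psi M T x h (π w) +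
      ∑ h, (∑ w ∈ Y, ind (hist T x w = h)) * (Sh M T x h / Nh T x h) := by
    simp only [e, Finset.sum_add_distrib, mem_Gp.1 hπ]
    rw [Finset.sum_comm]
    congr 1
    rw [Finset.sum_comm]
    exact Finset.sum_congr rfl fun h _ => by rw [Finset.sum_mul]
  have e3 : ∀ h, (∑ w ∈ Y, ind (hist T x w = h)) * (Sh M T x h / Nh T x h) ≤
      0.94 * (∑ w ∈ Y, ind (hist T x w = h)) + t := by
    intro h
    have y0 : 0 ≤ ∑ w ∈ Y, ind (hist T x w = h) := Finset.sum_nonneg fun _ _ => ind_nonneg _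
    have yN : ∑ w ∈ Y, ind (hist T x w = h) ≤ Nh T x h :=
      Finset.sum_le_sum_of_subset_of_nonneg (Finset.subset_univ _) fun _ _ _ => ind_nonneg _
    by_cases h0 : Nh T x h = 0
    · rw [h0]; simp; positivity
    · have hN : 0 < Nh T x h := lt_of_le_of_ne (y0.trans yN) (Ne.symm h0)
      rw [mul_div_assoc', div_le_iff₀ hN]
      have := hS h
      nlinarith [mul_le_mul_of_nonneg_left this y0, mul_le_mul_of_nonneg_left yN ht]
  have e4 : ∑ h, ∑ w ∈ Y, ind (hist T x w = h) = Y.card := by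
    rw [Finset.sum_comm]; simp [one]
  have e5 := Finset.sum_le_sum fun h (_ : h ∈ (univ : Finset (Fin (T + 1) → Fin 3))) => e3 h
  rw [Finset.sum_add_distrib, ← Finset.mul_sum, e4, Finset.sum_const, nsmul_eq_mul,
    Finset.card_univ] at e5
  rw [e2]; linarith

def Good {n : ℕ} (M T k : ℕ) (x : Fin n → DD n) : Prop := ∃ U : Finset (Fin n), U.card ≤ k ∧ Closed M T x U

lemma main_pt {n M T k m : ℕ} {x : Fin n → DD n} {π : Equiv.Perm (Fin n)}
    (hπ : π ∈ Gp (hist T x)) {t : ℝ} (ht : 0 ≤ t) (hm : (m:ℝ) ≤ 1.02 * k + 1)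
    (htk : Fintype.card (Fin (T + 1) → Fin 3) * t + 1 ≤ 0.01 * k)
    (hg : ¬ Good M T k (act π x)) (hsp : ¬ ∃ Y : Finset (Fin n), Y.card = k ∧ m ≤ arcs (act π x) Y)
    (hB : 2 * ((BB M T x).card : ℝ) ≤ 0.01 * k)
    (hS : ∀ h, Sh M T x h ≤ 0.94 * Nh T x h + t) :
    ∃ h, 0.02 * k / Fintype.card (Fin (T + 1) → Fin 3) ≤ sE (nxtv M T x) (psi M T x h) k π := by
  have hN := nxtv_ok M T x
  have hk : (expl (nxtv M T x) π k).card = k := by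
    rcases expl_card hN π k with h | ⟨h1, h2⟩
    · exact h
    · exact absurd ⟨_, h1, nxtv_none hπ h2⟩ hg
  set Y := expl (nxtv M T x) π k with hY
  have c1 := count (M := M) (act π x) Y (by rw [act_BB hπ]; exact expl_touch hπ k)
  rw [act_BB hπ] at c1
  simp only [sn_act hπ] at c1
  have c2 := sn_decomp hπ Y ht hS
  have c3 : (arcs (act π x) Y : ℝ) ≤ m := by
    by_contra hc
    exact hsp ⟨Y, hk, by exact_mod_cast (not_le.1 hc).le⟩
  rw [hk] at c1 c2
  have c4 : 0.02 * (k:ℝ) ≤ ∑ h, sE (nxtv M T x) (psi M T x h) k π := by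
    unfold sE
    rw [← hY]
    linarith
  by_contra hc
  push Not at hc
  have hcard : (0:ℝ) < Fintype.card (Fin (T + 1) → Fin 3) := by
    exact_mod_cast Fintype.card_pos
  have := Finset.sum_lt_sum_of_nonempty (s := univ) Finset.univ_nonempty fun h _ => hc h
  rw [Finset.sum_const, nsmul_eq_mul, Finset.card_univ, mul_div_cancel₀ _ hcard.ne'] at this
  linarith

end WLA

namespace WLA
open Finset

lemma fail_bound {n : ℕ} {p C : ℝ} (H : Hyp n p C) {M T k m : ℕ} (hM : 0 < M) (hk : 0 < k)
    (hkm : 51 * k ≤ 50 * m) (hm : (m:ℝ) ≤ 1.02 * k + 1)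
    {η : ℝ} (hkη : (k : ℝ) ≤ η * n) (hη1 : Real.exp 1 * C * η ≤ 1)
    (hη2 : Real.exp 1 ^ 101 * C ^ 51 * η ≤ (1 / 2) ^ 50) {t : ℝ} (ht : 0 < t) (hA : 0 ≤ A2 C M T)
    {h3 : ℝ} (hh3 : h3 = Fintype.card (Fin (T + 1) → Fin 3))
    (htk : h3 * (A2 C M T + t) + 1 ≤ 0.01 * k) :
    Ex (om n p) (fun x => ind (¬ Good M T k x)) ≤ (1 / 2) ^ k +
      (0.94 ^ T * n + AA C T + n * C / M) / (0.005 * k) +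
      h3 * (2 * (M + 1 : ℝ) ^ 2 * KK C (T + 1) ^ 2 * n / t ^ 2) +
      h3 * (n * (C + C ^ 2) / (0.02 * k / h3) ^ 2) := by
  have hk' : (0:ℝ) < k := by exact_mod_cast hk
  have h3pos : 0 < h3 := by
    rw [hh3]; exact_mod_cast Fintype.card_pos
  set y : ℝ := 0.02 * k / h3 with hy
  have hy0 : 0 < y := by positivity
  set Z : (Fin n → DD n) → ℝ := fun x => ∑ u, (∑ v, ind (u ∈ Sd (x v))) ^ 2 with hZ
  set Sp : (Fin n → DD n) → ℝ := fun x => ind (∃ Y : Finset (Fin n), Y.card = k ∧ m ≤ arcs x Y) with hSp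
  set Bd : (Fin n → DD n) → ℝ := fun x => ind (0.005 * (k:ℝ) ≤ (BB M T x).card) with hBd
  set Sb : (Fin n → DD n) → ℝ := fun x => ∑ h, ind (0.94 * ∑ v, ind (hist T x v = h) + (A2 C M T + t) ≤
      ∑ v, contr M T h (x v) x) with hSb
  have pt : ∀ x : Fin n → DD n, ∀ π ∈ Gp (hist T x), ind (¬ Good M T k (act π x)) ≤
      Sp (act π x) + (Bd x + Sb x) + ∑ h, ind (y ≤ sE (nxtv M T x) (psi M T x h) k π) := by
    intro x π hπ
    have n1 : 0 ≤ Sp (act π x) := ind_nonneg _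
    have n2 : 0 ≤ Bd x := ind_nonneg _
    have n3 : 0 ≤ Sb x := Finset.sum_nonneg fun _ _ => ind_nonneg _
    have n4 : 0 ≤ ∑ h, ind (y ≤ sE (nxtv M T x) (psi M T x h) k π) :=
      Finset.sum_nonneg fun _ _ => ind_nonneg _
    by_cases hg : Good M T k (act π x)
    · rw [ind_false (not_not.2 hg)]; linarith
    have i1 := ind_le_one (¬ Good M T k (act π x))
    by_cases hsp : ∃ Y : Finset (Fin n), Y.card = k ∧ m ≤ arcs (act π x) Y
    · have : Sp (act π x) = 1 := ind_true hsp
      linarith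
    by_cases hB : 0.005 * (k:ℝ) ≤ (BB M T x).card
    · have : Bd x = 1 := ind_true hB
      linarith
    by_cases hS : ∃ h, 0.94 * ∑ v, ind (hist T x v = h) + (A2 C M T + t) ≤ ∑ v, contr M T h (x v) x
    · obtain ⟨h, hh⟩ := hS
      have : 1 ≤ Sb x := by
        rw [← ind_true hh]
        exact Finset.single_le_sum (f := fun h => ind (0.94 * ∑ v, ind (hist T x v = h) +
          (A2 C M T + t) ≤ ∑ v, contr M T h (x v) x)) (fun _ _ => ind_nonneg _) (Finset.mem_univ h)
      linarith
    push Not at hS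
    obtain ⟨h, hh⟩ := main_pt (t := A2 C M T + t) hπ (by linarith) hm (by rw [← hh3]; exact htk)
      hg hsp (by linarith) (fun h => by
        have := (hS h).le
        rw [contr_sum] at this
        exact this)
    rw [← hh3] at hh
    have : 1 ≤ ∑ h, ind (y ≤ sE (nxtv M T x) (psi M T x h) k π) := by
      rw [← ind_true hh]
      exact Finset.single_le_sum (f := fun h => ind (y ≤ sE (nxtv M T x) (psi M T x h) k π))
        (fun _ _ => ind_nonneg _) (Finset.mem_univ h)
    linarith
  rw [← Ex_avg p T]
  have pt2 : ∀ x : Fin n → DD n,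
      (∑ π ∈ Gp (hist T x), ind (¬ Good M T k (act π x))) / (Gp (hist T x)).card ≤
      (∑ π ∈ Gp (hist T x), Sp (act π x)) / (Gp (hist T x)).card + (Bd x + Sb x) +
        h3 / y ^ 2 * Z x := by
    intro x
    have hG : (0:ℝ) < (Gp (hist T x)).card := by exact_mod_cast Gp_card_pos _
    have a := Finset.sum_le_sum (pt x)
    rw [Finset.sum_add_distrib, Finset.sum_add_distrib, Finset.sum_const, nsmul_eq_mul,
      Finset.sum_comm] at a
    have b : ∀ h, (∑ π ∈ Gp (hist T x), ind (y ≤ sE (nxtv M T x) (psi M T x h) k π)) /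
        (Gp (hist T x)).card ≤ Z x / y ^ 2 := by
      intro h
      refine (lemE_cheb (nxtv_ok M T x) (hist T x) h (psi M T x h) ?_ (psi_sum M T x h) k hy0).trans ?_
      · intro u hu; unfold psi; rw [ind_false hu, zero_mul]
      · gcongr; exact psi_sq M T x h
    have b2 := Finset.sum_le_sum fun h (_ : h ∈ (univ : Finset (Fin (T + 1) → Fin 3))) => b h
    rw [Finset.sum_const, nsmul_eq_mul, Finset.card_univ, ← hh3, ← Finset.sum_div] at b2
    refine (div_le_div_of_nonneg_right a hG.le).trans ?_
    rw [add_div, add_div, mul_div_assoc, mul_comm (((Gp (hist T x)).card : ℕ) : ℝ), div_mul_cancel₀ _ hG.ne']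
    have : h3 / y ^ 2 * Z x = h3 * (Z x / y ^ 2) := by ring
    linarith
  refine (Ex_mono H.om0 pt2).trans ?_
  rw [Ex_add, Ex_add, Ex_add, Ex_mul_left, Ex_avg p T Sp]
  have r1 : Ex (om n p) Sp ≤ (1 / 2) ^ k := sparse H hk hkm hkη hη1 hη2
  have r2 : Ex (om n p) Bd ≤ (0.94 ^ T * n + AA C T + n * C / M) / (0.005 * k) := by
    have : ∀ x, Bd x ≤ (1 / (0.005 * k)) * ((BB M T x).card : ℝ) := by
      intro x
      refine (ind_le_div (Nat.cast_nonneg _) (by positivity)).trans (le_of_eq (by ring))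
    refine (Ex_mono H.om0 this).trans ?_
    rw [Ex_mul_left, one_div, inv_mul_eq_div]
    gcongr
    exact S1 H hM T
  have r3 : Ex (om n p) Sb ≤ h3 * (2 * (M + 1 : ℝ) ^ 2 * KK C (T + 1) ^ 2 * n / t ^ 2) := by
    rw [hSb, Ex_sum]
    refine (Finset.sum_le_sum fun h _ => S2 H M T h ht).trans (le_of_eq ?_)
    rw [Finset.sum_const, nsmul_eq_mul, Finset.card_univ, ← hh3]
  have r4 : h3 / y ^ 2 * Ex (om n p) Z ≤ h3 * (n * (C + C ^ 2) / y ^ 2) := by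
    have := mul_le_mul_of_nonneg_left (indeg2 H) (by positivity : 0 ≤ h3 / y ^ 2)
    refine this.trans (le_of_eq (by ring))
  linarith

end WLA

namespace WLA
open Finset Filter

lemma KK_nonneg' {C : ℝ} (hC : 0 ≤ C) (r : ℕ) : 0 ≤ KK C r := by
  induction r with
  | zero => simp [KK]
  | succ r ih => unfold KK; positivity

lemma A2_nonneg {C : ℝ} (hC : 0 ≤ C) (M T : ℕ) : 0 ≤ A2 C M T := by
  have := KK_nonneg' hC T
  unfold A2; positivity

lemma asym {C : ℝ} (hC : 0 < C) {ε ξ : ℝ} (hε : 0 < ε) (hξ : 0 < ξ) :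
    ∃ M T : ℕ, ∀ᶠ n : ℕ in atTop, ∀ p : ℝ, 0 ≤ p → p ≤ C / n → p ≤ 1 ∧ 
      ∃ k : ℕ, (k:ℝ) ≤ ε * n ∧ Ex (om n p) (fun x => ind (¬ Good M T k x)) ≤ ξ := by
  have heC : 0 < Real.exp 1 * C := by positivity
  have heC2 : 0 < Real.exp 1 ^ 101 * C ^ 51 := mul_pos (pow_pos (Real.exp_pos 1) _) (pow_pos hC _)
  obtain ⟨q50, hq50⟩ : ∃ q : ℝ, q = (1 / 2) ^ 50 := ⟨_, rfl⟩
  have hq : 0 < q50 := by rw [hq50]; exact pow_pos (by norm_num) _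
  set η : ℝ := min ε (min (1 / (Real.exp 1 * C)) (q50 / (Real.exp 1 ^ 101 * C ^ 51))) with hηd
  have hη : 0 < η := lt_min hε (lt_min (one_div_pos.2 heC) (div_pos hq heC2))
  have hηε : η ≤ ε := min_le_left _ _
  have hη1 : Real.exp 1 * C * η ≤ 1 := by
    have : η ≤ 1 / (Real.exp 1 * C) := (min_le_right _ _).trans (min_le_left _ _)
    rw [le_div_iff₀ heC] at this; linarith
  have hη2 : Real.exp 1 ^ 101 * C ^ 51 * η ≤ (1 / 2) ^ 50 := by
    have : η ≤ q50 / (Real.exp 1 ^ 101 * C ^ 51) := (min_le_right _ _).trans (min_le_right _ _)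
    rw [le_div_iff₀ heC2] at this
    rw [← hq50, mul_comm]; exact this
  clear_value η
  clear hηd heC2 heC hq hq50
  set β : ℝ := 0.0025 * η * ξ / 12 with hβ
  have hβ0 : 0 < β := by positivity
  obtain ⟨T, hT⟩ := exists_pow_lt_of_lt_one hβ0 (by norm_num : (0.94:ℝ) < 1)
  obtain ⟨M, hM⟩ := exists_nat_gt (C / β)
  have hM0 : (0:ℝ) < M := lt_trans (by positivity) hM
  have hMn : 0 < M := by exact_mod_cast hM0
  have hCM : C / M ≤ β := by
    rw [div_le_iff₀ hM0]; rw [div_lt_iff₀ hβ0] at hM; linarith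
  obtain ⟨K0, hK0⟩ := exists_pow_lt_of_lt_one (by positivity : 0 < ξ / 4) (by norm_num : (1/2:ℝ) < 1)
  obtain ⟨h3, hh3⟩ : ∃ h3 : ℝ, h3 = Fintype.card (Fin (T + 1) → Fin 3) := ⟨_, rfl⟩
  have h3pos : 0 < h3 := by
    rw [hh3]; exact_mod_cast Fintype.card_pos
  set ζ : ℝ := 0.0025 * η / h3 with hζ
  have hζ0 : 0 < ζ := by positivity
  have hA := A2_nonneg hC.le M T
  obtain ⟨X, hX⟩ : ∃ X : ℝ, X = h3 * (2 * (M + 1 : ℝ) ^ 2 * KK C (T + 1) ^ 2) := ⟨_, rfl⟩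
  obtain ⟨W, hW⟩ : ∃ W : ℝ, W = h3 ^ 3 * (C + C ^ 2) / (0.01 * η) ^ 2 := ⟨_, rfl⟩
  refine ⟨M, T, ?_⟩
  have ev : ∀ a : ℝ, ∀ᶠ n : ℕ in atTop, a ≤ (n:ℝ) := fun a =>
    tendsto_natCast_atTop_atTop.eventually_ge_atTop a
  filter_upwards [ev 1, ev (2 * C + 1), ev (200 * C ^ 2), ev (2 / η), ev (AA C T / β),
    ev (2 * K0 / η), ev ((h3 * A2 C M T + 1) / (0.0025 * η)), ev (4 * X / (ξ * ζ ^ 2)),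
    ev (4 * W / ξ)] with n g1 g2 g3 g4 g5 g6 g7 g8 g9 p hp0 hp
  have hn : (0:ℝ) < n := by linarith
  have hn' : 0 < n := by exact_mod_cast hn
  have hnp : (n:ℝ) * p ≤ C := by rw [le_div_iff₀ hn] at hp; linarith
  have hp1 : p < 1 := by
    by_contra hc
    push Not at hc
    nlinarith
  have H : Hyp n p C := ⟨hn', hp0, hp1, hC.le, hnp, B_bound hC.le hn' hp0 hp (by linarith) g3⟩
  refine ⟨hp1.le, ⌊η * n⌋₊, ?_, ?_⟩
  · refine (Nat.floor_le (by positivity)).trans ?_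
    gcongr
  set k := ⌊η * n⌋₊ with hk
  have k1 : (k:ℝ) ≤ η * n := Nat.floor_le (by positivity)
  have k2 : η * n < k + 1 := Nat.lt_floor_add_one _
  rw [div_le_iff₀ hη] at g4 g6
  have k3 : η * n / 2 ≤ k := by linarith
  have k0 : (0:ℝ) < k := lt_of_lt_of_le (by positivity) k3
  have k0' : 0 < k := by exact_mod_cast k0
  have kK : K0 ≤ k := by
    have : (K0:ℝ) ≤ k := by linarith
    exact_mod_cast this
  have hm : ((k + k / 50 + 1 : ℕ) : ℝ) ≤ 1.02 * k + 1 := by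
    have : ((k / 50 : ℕ) : ℝ) ≤ (k:ℝ) / 50 := by exact_mod_cast Nat.cast_div_le (α := ℝ) (m := k) (n := 50)
    push_cast
    linarith
  have htk : h3 * (A2 C M T + ζ * n) + 1 ≤ 0.01 * k := by
    rw [div_le_iff₀ (by positivity)] at g7
    have : h3 * (ζ * n) = 0.0025 * η * n := by rw [hζ]; field_simp
    rw [mul_add, this]
    linarith
  refine (fail_bound H (m := k + k / 50 + 1) hMn k0' (by omega) hm k1 hη1 hη2
    (t := ζ * n) (by positivity) hA hh3 htk).trans ?_
  have t1 : (1 / 2 : ℝ) ^ k ≤ ξ / 4 :=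
    (pow_le_pow_of_le_one (by norm_num) (by norm_num) kK).trans hK0.le
  have t2 : (0.94 ^ T * n + AA C T + n * C / M) / (0.005 * k) ≤ ξ / 4 := by
    rw [div_le_iff₀ (by positivity)]
    rw [div_le_iff₀ hβ0] at g5
    have a1 : (0.94:ℝ) ^ T * n ≤ β * n := by gcongr
    have a2 : n * C / M ≤ β * n := by
      rw [mul_div_assoc, mul_comm]; gcongr
    have a3 : ξ / 4 * (0.005 * (η * n / 2)) ≤ ξ / 4 * (0.005 * k) := by gcongr
    have a4 : 3 * (β * n) = ξ / 4 * (0.005 * (η * n / 2)) := by rw [hβ]; ring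
    linarith
  have t3 : h3 * (2 * (M + 1 : ℝ) ^ 2 * KK C (T + 1) ^ 2 * n / (ζ * n) ^ 2) ≤ ξ / 4 := by
    have : h3 * (2 * (M + 1 : ℝ) ^ 2 * KK C (T + 1) ^ 2 * n / (ζ * n) ^ 2) = X / (ζ ^ 2 * n) := by
      rw [hX]; field_simp
    rw [this, div_le_iff₀ (by positivity)]
    rw [div_le_iff₀ (by positivity)] at g8
    linarith
  have t4 : h3 * (n * (C + C ^ 2) / (0.02 * k / h3) ^ 2) ≤ ξ / 4 := by
    rw [div_le_iff₀ hξ] at g9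
    calc h3 * (n * (C + C ^ 2) / (0.02 * k / h3) ^ 2)
        ≤ h3 * (n * (C + C ^ 2) / (0.02 * (η * n / 2) / h3) ^ 2) := by gcongr
      _ = W / n := by rw [hW]; field_simp; ring
      _ ≤ ξ / 4 := by rw [div_le_iff₀ hn]; linarith
  linarith

end WLA

namespace WLA
open Finset

lemma closed_maj {n M T : ℕ} {x : Fin n → DD n} {U : Finset (Fin n)} (hU : Closed M T x U)
    (c' : Fin n → Fin 3) (hc' : ∀ v, v ∉ U → c' v = col x T v) (v : Fin n) (hv : v ∉ U) :
    MajorityAt (fun v => (x v).2) c' v := by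
  classical
  obtain ⟨hB, ht⟩ := hU v hv
  have hcv : col x T v = rule (x v) (col x T) := by
    by_contra hne
    exact hB (by simp only [BB, Finset.mem_filter, Finset.mem_univ, true_and]; exact Or.inl hne)
  unfold touch at ht
  push Not at ht
  obtain ⟨ht1, ht2⟩ := ht
  set c := col x T with hc
  set a := rule (x v) c with ha
  have hval := rule_valid (x v) c
  rw [← ha] at hval
  set S := Sd (x v) with hS
  have hc'v : c' v = a := (hc' v hv).trans hcv
  set P := {w ∈ S | w ∉ U ∧ c w = a} with hP
  have b1 : #{w ∈ S | c' w = a} ≤ #P + #{w ∈ U | w ∈ S} := by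
    refine (Finset.card_le_card ?_).trans (Finset.card_union_le _ _)
    intro w hw
    simp only [hP, Finset.mem_union, Finset.mem_filter] at hw ⊢
    by_cases hwU : w ∈ U
    · exact Or.inr ⟨hwU, hw.1⟩
    · exact Or.inl ⟨hw.1, hwU, by rw [← hc' w hwU]; exact hw.2⟩
  have b2 : #P ≤ cnt (x v) c a := Finset.card_le_card fun w hw => by
    simp only [hP, Finset.mem_filter] at hw ⊢
    exact ⟨hw.1, hw.2.2⟩
  have key : 2 * #{w ∈ S | c' w = a} ≤ S.card := by
    rcases Nat.eq_zero_or_pos (#{w ∈ U | w ∈ S}) with h0 | h0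
    · omega
    · obtain ⟨w, hw⟩ := Finset.card_pos.1 h0
      rw [Finset.mem_filter] at hw
      have hns := ht1 w hw.1 hw.2
      by_cases hwa : c w = a
      · have b3 : #P + 1 ≤ cnt (x v) c a := by
          have hwP : w ∉ P := by simp [hP, hw.1]
          rw [← Finset.card_insert_of_notMem hwP]
          refine Finset.card_le_card fun u hu => ?_
          rw [Finset.mem_insert] at hu
          rcases hu with rfl | hu
          · exact Finset.mem_filter.2 ⟨hw.2, hwa⟩
          · simp only [hP, Finset.mem_filter] at hu ⊢
            exact ⟨hu.1, hu.2.2⟩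
        omega
      · have : cnt (x v) c a ≠ S.card / 2 := fun h => hns ⟨hwa, h⟩
        omega
  unfold MajorityAt DiAdj
  have s1 : ({w | (v ≠ w ∧ (fun v => (x v).2) v w = true) ∧ c' w = c' v} : Set (Fin n)) =
      (({w ∈ S | c' w = a}.erase v : Finset (Fin n)) : Set (Fin n)) := by
    ext w
    simp only [hc'v, Finset.coe_erase, Finset.coe_filter, hS, mem_Sd, Set.mem_sdiff,
      Set.mem_ofPred_eq, Set.mem_singleton_iff]
    constructor
    · rintro ⟨⟨h1, h2⟩, h3⟩; exact ⟨⟨h2, h3⟩, fun h => h1 h.symm⟩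
    · rintro ⟨⟨h2, h3⟩, h1⟩; exact ⟨⟨fun h => h1 h.symm, h2⟩, h3⟩
  have s2 : ({w | v ≠ w ∧ (fun v => (x v).2) v w = true} : Set (Fin n)) =
      ((S.erase v : Finset (Fin n)) : Set (Fin n)) := by
    ext w
    simp only [Finset.coe_erase, hS, Set.mem_sdiff, Finset.mem_coe, mem_Sd,
      Set.mem_ofPred_eq, Set.mem_singleton_iff]
    constructor
    · rintro ⟨h1, h2⟩; exact ⟨h2, fun h => h1 h.symm⟩
    · rintro ⟨h2, h1⟩; exact ⟨fun h => h1 h.symm, h2⟩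
  rw [s1, s2, Set.ncard_coe_finset, Set.ncard_coe_finset]
  by_cases hvS : v ∈ S
  · rw [Finset.card_erase_of_mem hvS, Finset.card_erase_of_mem (by simp [hvS, hc'v])]
    omega
  · rw [Finset.erase_eq_of_notMem hvS, Finset.erase_eq_of_notMem (by simp [hvS])]
    exact key

/-- The event of the theorem, with `ℓ = 0`. -/
def TargetEv (n : ℕ) (ε : ℝ) : Set (Fin n → Fin n → Bool) :=
          {A | ∃ (U : Set (Fin n)) (c : Fin n → Fin 3) (L : Fin n → Finset (Fin 3)),
            (∀ c' : Fin n → Fin 3, (∀ v ∈ U, c' v ∈ L v) → (∀ v ∉ U, c' v = c v) →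
              ∀ v ∉ U, MajorityAt A c' v) ∧
            ((U.ncard : ℝ) ≤ ε * n) ∧
            (∀ v ∈ U, (L v).card = 2 ∨ (L v).card = 3) ∧
            (∀ (m : ℕ) (f : Fin (m + 1) → Fin n), Function.Injective f →
              (∀ i, f i ∈ U) → (∀ i : Fin (m + 1), DiAdj A (f i) (f (i + 1))) →
              ∃ i j : Fin (m + 1), i ≠ j ∧ (L (f i)).card = 3 ∧ (L (f j)).card = 3) ∧
            (∀ f : Fin (0 + 1) → Fin n, Function.Injective f →
              (∀ i, f i ∈ U) → (∀ i : Fin 0, DiAdj A (f i.castSucc) (f i.succ)) →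
              ∃ i, (L (f i)).card = 3)}

lemma good_ev {n M T k : ℕ} {ε : ℝ} {x : Fin n → DD n} (hk : (k:ℝ) ≤ ε * n) (hg : Good M T k x) :
    (fun v => (x v).2) ∈ TargetEv n ε := by
  obtain ⟨U, hUk, hU⟩ := hg
  refine ⟨(U : Set (Fin n)), col x T, fun _ => univ, ?_, ?_, ?_, ?_, ?_⟩
  · intro c' _ h v hv
    exact closed_maj hU c' (fun w hw => h w (by simpa using hw)) v (by simpa using hv)
  · rw [Set.ncard_coe_finset]
    exact le_trans (by exact_mod_cast hUk) hk
  · intro v _; right; simp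
  · intro m f _ _ hadj
    rcases Nat.eq_zero_or_pos m with rfl | hm
    · exact absurd (congrArg f (Fin.ext (by omega))) (hadj 0).1
    · refine ⟨0, Fin.last m, ?_, by simp, by simp⟩
      intro h
      have := congrArg Fin.val h
      simp at this
      omega
  · intro f _ _ _; exact ⟨0, by simp⟩

lemma marg {n : ℕ} (p : ℝ) (F : (Fin n → Fin n → Bool) → ℝ) :
    Ex (om n p) (fun x : Fin n → DD n => F (fun v => (x v).2)) =
      ∑ A : Fin n → Fin n → Bool, (∏ v, ∏ w, bw p (A v w)) * F A := by
  unfold Ex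
  rw [← Equiv.sum_comp (Equiv.arrowProdEquivProdArrow (Fin n) (fun _ => Fin 3)
    (fun _ => Fin n → Bool)).symm, Fintype.sum_prod_type]
  have e : ∀ (a : Fin n → Fin 3) (A : Fin n → Fin n → Bool),
      wt (om n p) ((Equiv.arrowProdEquivProdArrow (Fin n) (fun _ => Fin 3)
        (fun _ => Fin n → Bool)).symm (a, A)) * F (fun v => ((Equiv.arrowProdEquivProdArrow (Fin n)
        (fun _ => Fin 3) (fun _ => Fin n → Bool)).symm (a, A) v).2) =
      (1 / 3) ^ n * ((∏ v, ∏ w, bw p (A v w)) * F A) := by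
    intro a A
    rw [← mul_assoc]
    congr 1
    simp [wt, om, Finset.prod_mul_distrib]
  simp only [e]
  rw [Finset.sum_const, nsmul_eq_mul, ← Finset.mul_sum, ← mul_assoc]
  have : ((univ : Finset (Fin n → Fin 3)).card : ℝ) * (1 / 3) ^ n = 1 := by
    simp [Finset.card_univ]
  rw [this, one_mul]

lemma bern_singleton {p : ℝ} (h0 : 0 ≤ p) (h1 : p ≤ 1) (b : Bool) :
    bernoulliM p {b} = ENNReal.ofReal (bw p b) := by
  unfold bernoulliM bw
  cases b <;> simp [ENNReal.ofReal]

lemma bern_prob {p : ℝ} (h0 : 0 ≤ p) (h1 : p ≤ 1) : IsProbabilityMeasure (bernoulliM p) := by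
  constructor
  unfold bernoulliM
  simp
  rw [← ENNReal.coe_add, ← Real.toNNReal_add h0 (by linarith)]
  simp

lemma di_singleton {n : ℕ} {p : ℝ} (h0 : 0 ≤ p) (h1 : p ≤ 1) (A : Fin n → Fin n → Bool) :
    diMeasure n p {A} = ENNReal.ofReal (∏ v, ∏ w, bw p (A v w)) := by
  unfold diMeasure
  rw [Measure.pi_singleton]
  simp only [Measure.pi_singleton, bern_singleton h0 h1]
  rw [ENNReal.ofReal_prod_of_nonneg (fun v _ => Finset.prod_nonneg fun w _ => bw_nonneg h0 h1 _)]
  exact Finset.prod_congr rfl fun v _ =>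
    (ENNReal.ofReal_prod_of_nonneg (fun w _ => bw_nonneg h0 h1 _)).symm

lemma di_le {n : ℕ} {p : ℝ} (h0 : 0 ≤ p) (h1 : p ≤ 1) (E : Set (Fin n → Fin n → Bool)) :
    diMeasure n p E = ENNReal.ofReal (Ex (om n p) (fun x : Fin n → DD n =>
      ind ((fun v => (x v).2) ∈ E))) := by
  classical
  rw [marg p (fun A => ind (A ∈ E))]
  have : E = ((univ.filter fun A => A ∈ E : Finset (Fin n → Fin n → Bool)) : Set _) := by ext; simp
  conv_lhs => rw [this]
  rw [← sum_measure_singleton]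
  simp only [di_singleton h0 h1]
  rw [← ENNReal.ofReal_sum_of_nonneg
    (fun A _ => Finset.prod_nonneg fun v _ => Finset.prod_nonneg fun w _ => bw_nonneg h0 h1 _),
    Finset.sum_filter]
  congr 1
  refine Finset.sum_congr rfl fun A _ => ?_
  by_cases hA : A ∈ E
  · simp [hA, ind]
  · simp [hA, ind]

lemma di_prob {n : ℕ} {p : ℝ} (h0 : 0 ≤ p) (h1 : p ≤ 1) : IsProbabilityMeasure (diMeasure n p) := by
  have := bern_prob h0 h1
  unfold diMeasure
  infer_instance

end WLA

/-- Lemma 2.5 (list-assignment): fix `C ≥ 0.1`. There is `ℓ ∈ ℕ` (depending only on `C`)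
such that for `0.1/n ≤ pₙ ≤ C/n` and any `ε > 0`, whp `𝔻(n,pₙ)` admits a set `U`, a
colouring `c` outside `U` and lists `L` on `U` satisfying (L1)–(L5). -/
theorem whp_list_assignment (C : ℝ) (hC : 0.1 ≤ C) :
    ∃ ℓ : ℕ, ∀ p : ℕ → ℝ, (∀ n, p n ∈ Set.Icc (0 : ℝ) 1) →
      (∀ n : ℕ, 0.1 / n ≤ p n ∧ p n ≤ C / n) →
      ∀ ε : ℝ, 0 < ε →
      Tendsto (fun n => diMeasure n (p n)
          {A | ∃ (U : Set (Fin n)) (c : Fin n → Fin 3) (L : Fin n → Finset (Fin 3)),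
            -- (L1): any completion of `c` by colours from the lists on `U` leaves every
            -- vertex outside `U` majority-coloured
            (∀ c' : Fin n → Fin 3, (∀ v ∈ U, c' v ∈ L v) → (∀ v ∉ U, c' v = c v) →
              ∀ v ∉ U, MajorityAt A c' v) ∧
            -- (L2): `U` is small
            ((U.ncard : ℝ) ≤ ε * n) ∧
            -- (L3): lists have size 2 or 3
            (∀ v ∈ U, (L v).card = 2 ∨ (L v).card = 3) ∧
            -- (L4): every directed cycle inside `U` has at least two vertices with
            -- list size 3
            (∀ (m : ℕ) (f : Fin (m + 1) → Fin n), Function.Injective f →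
              (∀ i, f i ∈ U) → (∀ i : Fin (m + 1), DiAdj A (f i) (f (i + 1))) →
              ∃ i j : Fin (m + 1), i ≠ j ∧ (L (f i)).card = 3 ∧ (L (f j)).card = 3) ∧
            -- (L5): every directed path of length `ℓ` inside `U` has a vertex with
            -- list size 3
            (∀ f : Fin (ℓ + 1) → Fin n, Function.Injective f →
              (∀ i, f i ∈ U) → (∀ i : Fin ℓ, DiAdj A (f i.castSucc) (f i.succ)) →
              ∃ i, (L (f i)).card = 3)})
        atTop (nhds 1) := by
  have hC0 : 0 < C := by linarith
  refine ⟨0, fun p hp01 hp ε hε => ?_⟩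
  change Tendsto (fun n => diMeasure n (p n) (WLA.TargetEv n ε)) atTop (nhds 1)
  rw [ENNReal.tendsto_nhds ENNReal.one_ne_top]
  intro ξ' hξ'
  obtain ⟨ξ, hξ0, hξ⟩ : ∃ ξ : ℝ, 0 < ξ ∧ ENNReal.ofReal ξ ≤ ξ' := by
    refine ⟨(min ξ' 1).toReal, ENNReal.toReal_pos ?_ ?_, ?_⟩
    · exact (lt_min hξ' one_pos).ne'
    · exact ne_top_of_le_ne_top ENNReal.one_ne_top (min_le_right _ _)
    · exact ENNReal.ofReal_toReal_le.trans (min_le_left _ _)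
  obtain ⟨M, T, hev⟩ := WLA.asym hC0 hε hξ0
  filter_upwards [hev] with n hn
  obtain ⟨-, k, hk, hb⟩ := hn (p n) (hp01 n).1 (hp n).2
  have h0 := (hp01 n).1
  have h1 := (hp01 n).2
  have := WLA.di_prob (n := n) h0 h1
  refine ⟨?_, prob_le_one.trans le_self_add⟩
  have hc : diMeasure n (p n) (WLA.TargetEv n ε)ᶜ ≤ ξ' := by
    rw [WLA.di_le h0 h1]
    refine le_trans (ENNReal.ofReal_le_ofReal (le_trans ?_ hb)) hξ
    refine WLA.Ex_mono (WLA.om_nonneg h0 h1) fun x => WLA.ind_mono fun hx hg => hx ?_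
    exact WLA.good_ev hk hg
  have hm : MeasurableSet (WLA.TargetEv n ε) := (Set.toFinite _).measurableSet
  rw [tsub_le_iff_right, ← prob_add_prob_compl hm (μ := diMeasure n (p n))]
  gcongr
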